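/- arXiv:1605.05282 — 3 statements merged into one kernel-verified Lean document; each statement's English description precedes it below -/
import Mathlib

section
/- Let Z be a random vector in ℝ^k whose coordinates Z^{(1)}, ..., Z^{(k)} are independent standard normal random variables. Let f(x) = Σ_{m_1=0}^m ... Σ_{m_k=0}^m α(m_1,...,m_k) x_1^{m_1} ... x_k^{m_k} be a real polynomial with α(0,...,0) = 0, of total degree M = max{m_1 + ... + m_k : α(m_1,...,m_k) ≠ 0} ≥ 2, and let α_* = max |α(m_1,...,m_k)| > 0, where the maximum is over all (m_1,...,m_k) with 0 ≤ m_1,...,m_k ≤ m and m_1 + ... + m_k = M. Then there exist constants c_7, c_8 > 0 depending only on k, M, m such that for all real t, sup_{a ∈ ℝ^k} |E exp{i t f(Z + a)}| ≤ c_7 |α_* t|^{-1/m} ln^{c_8}(2 + |α_* t|). -/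
open MeasureTheory ProbabilityTheory Filter Set

lemma aux_pdf_le (x : ℝ) : (1 + |x|) * gaussianPDFReal 0 1 x ≤ 1 := by
  rw [gaussianPDFReal_def]
  have h1 : (2:ℝ) ≤ √(2 * Real.pi * ((1:NNReal):ℝ)) := by
    apply Real.le_sqrt_of_sq_le
    have := Real.pi_gt_three
    simp; linarith
  have h2 : (√(2 * Real.pi * ((1:NNReal):ℝ)))⁻¹ ≤ 1/2 := by
    rw [inv_eq_one_div]; exact one_div_le_one_div_of_le (by norm_num) h1
  have h3 : x^2/2 + 1 ≤ Real.exp (x^2/2) := Real.add_one_le_exp _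
  have h4 : 1 + |x| ≤ 2 * Real.exp (x^2/2) := by
    nlinarith [sq_nonneg (|x| - 1), sq_abs x, abs_nonneg x]
  have h5 : Real.exp (-(x - 0) ^ 2 / (2 * ((1:NNReal):ℝ))) = (Real.exp (x^2/2))⁻¹ := by
    rw [← Real.exp_neg]; congr 1; simp; ring
  simp only []
  rw [h5]
  have hp := Real.exp_pos (x^2/2)
  calc (1 + |x|) * ((√(2 * Real.pi * ((1:NNReal):ℝ)))⁻¹ * (Real.exp (x^2/2))⁻¹)
      ≤ (2 * Real.exp (x^2/2)) * (1/2 * (Real.exp (x^2/2))⁻¹) := by gcongr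
    _ = 1 := by field_simp

lemma aux_lint_rpow (δ : ℝ) (hδ : 0 < δ) :
    ∫⁻ y in Ioo (-1:ℝ) 1, ENNReal.ofReal (|y| ^ (δ - 1)) ≤ ENNReal.ofReal (2 / δ) := by
  have key : ∫⁻ y in Ioc (0:ℝ) 1, ENNReal.ofReal (|y| ^ (δ - 1)) = ENNReal.ofReal (1 / δ) := by
    have hi : IntervalIntegrable (fun y : ℝ => y ^ (δ - 1)) volume 0 1 :=
      intervalIntegral.intervalIntegrable_rpow' (by linarith)
    have e := integral_rpow (a := 0) (b := 1) (r := δ - 1) (Or.inl (by linarith))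
    rw [intervalIntegral.integral_of_le zero_le_one] at e
    have e2 : ∫⁻ y in Ioc (0:ℝ) 1, ENNReal.ofReal (|y| ^ (δ - 1))
        = ∫⁻ y in Ioc (0:ℝ) 1, ENNReal.ofReal (y ^ (δ - 1)) := by
      refine setLIntegral_congr_fun measurableSet_Ioc (fun y hy => ?_)
      rw [abs_of_pos hy.1]
    rw [e2, ← ofReal_integral_eq_lintegral_ofReal, e]
    · simp [hδ.ne']
    · exact (intervalIntegrable_iff_integrableOn_Ioc_of_le zero_le_one).1 hi
    · filter_upwards [ae_restrict_mem measurableSet_Ioc] with y hy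
      exact Real.rpow_nonneg hy.1.le _
  have key2 : ∫⁻ y in Ico (-1:ℝ) 0, ENNReal.ofReal (|y| ^ (δ - 1)) = ENNReal.ofReal (1 / δ) := by
    rw [← key, ← lintegral_indicator measurableSet_Ico, ← lintegral_indicator measurableSet_Ioc,
      ← lintegral_neg_eq_self]
    congr 1; ext y
    simp only [indicator, mem_Ico, mem_Ioc, abs_neg]
    congr 1
    apply propext; constructor <;> rintro ⟨h1, h2⟩ <;> constructor <;> linarith
  have hsub : Ioo (-1:ℝ) 1 ≤ᵐ[volume] (Ico (-1:ℝ) 0 ∪ Ioc 0 1 : Set ℝ) := by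
    have : ∀ᵐ y : ℝ, y ≠ 0 := by simp [ae_iff]
    filter_upwards [this] with y hy h
    rcases lt_or_gt_of_ne hy with h0 | h0
    · exact Or.inl ⟨h.1.le, h0⟩
    · exact Or.inr ⟨h0, h.2.le⟩
  calc _ ≤ ∫⁻ y in (Ico (-1:ℝ) 0 ∪ Ioc 0 1 : Set ℝ), ENNReal.ofReal (|y| ^ (δ - 1)) :=
        lintegral_mono' (Measure.restrict_mono_ae hsub) le_rfl
    _ ≤ _ := lintegral_union_le _ _ _
    _ = _ := by rw [key, key2, ← ENNReal.ofReal_add (by positivity) (by positivity)]; congr 1; ring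

lemma aux_sing : ∃ C : ℝ, 0 < C ∧ ∀ δ : ℝ, 0 < δ → δ ≤ 1 → ∀ ρ : ℝ,
    ∫⁻ x, ENNReal.ofReal ((1 + |x|) * |x - ρ| ^ (δ - 1)) ∂(gaussianReal 0 1)
      ≤ ENNReal.ofReal (C / δ) := by
  have hA : ∫⁻ x, ENNReal.ofReal (1 + |x|) ∂(gaussianReal 0 1) ≠ ⊤ := by
    have : Integrable (fun x : ℝ => 1 + |x|) (gaussianReal 0 1) := by
      have h := (memLp_id_gaussianReal (μ := 0) (v := 1) 1).integrable (by simp)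
      exact (integrable_const 1).add h.abs
    exact this.lintegral_lt_top.ne
  set A := ∫⁻ x, ENNReal.ofReal (1 + |x|) ∂(gaussianReal 0 1) with hAdef
  refine ⟨A.toReal + 2, by positivity, fun δ hδ hδ1 ρ => ?_⟩
  have hm1 : Measurable (fun x : ℝ => ENNReal.ofReal (1 + |x|)) := by fun_prop
  have hm2 : Measurable (fun y : ℝ => (Ioo (-1:ℝ) 1).indicator
      (fun y => ENNReal.ofReal (|y| ^ (δ - 1))) y) :=
    Measurable.indicator (by fun_prop) measurableSet_Ioo
  have hm2' : Measurable (fun x : ℝ => (Ioo (-1:ℝ) 1).indicator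
      (fun y => ENNReal.ofReal (|y| ^ (δ - 1))) (x - ρ)) :=
    hm2.comp (measurable_id.sub_const ρ)
  have hpt : ∀ x : ℝ, ENNReal.ofReal ((1 + |x|) * |x - ρ| ^ (δ - 1))
      ≤ ENNReal.ofReal (1 + |x|) + ENNReal.ofReal (1 + |x|) * (Ioo (-1:ℝ) 1).indicator
      (fun y => ENNReal.ofReal (|y| ^ (δ - 1))) (x - ρ) := by
    intro x
    rw [ENNReal.ofReal_mul (by positivity)]
    by_cases h : x - ρ ∈ Ioo (-1:ℝ) 1
    · rw [indicator_of_mem h]; exact le_add_self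
    · have h1 : 1 ≤ |x - ρ| := by
        by_contra hc
        exact h (abs_lt.1 (not_le.1 hc))
      have : |x - ρ| ^ (δ - 1) ≤ 1 := Real.rpow_le_one_of_one_le_of_nonpos h1 (by linarith)
      rw [indicator_of_notMem h, mul_zero, add_zero]
      calc _ ≤ ENNReal.ofReal (1 + |x|) * ENNReal.ofReal 1 := by gcongr
        _ = _ := by simp
  calc _ ≤ _ := lintegral_mono hpt
    _ = A + ∫⁻ x, ENNReal.ofReal (1 + |x|) * (Ioo (-1:ℝ) 1).indicator
      (fun y => ENNReal.ofReal (|y| ^ (δ - 1))) (x - ρ) ∂(gaussianReal 0 1) := by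
        rw [lintegral_add_left hm1]
    _ ≤ A + ENNReal.ofReal (2 / δ) := by
        gcongr
        rw [gaussianReal_of_var_ne_zero 0 one_ne_zero]
        refine (lintegral_withDensity_eq_lintegral_mul _ (measurable_gaussianPDF 0 1)
          (hm1.mul hm2')).trans_le ?_
        calc _ ≤ ∫⁻ x, (Ioo (-1:ℝ) 1).indicator
                (fun y => ENNReal.ofReal (|y| ^ (δ - 1))) (x - ρ) := by
              refine lintegral_mono fun x => ?_
              simp only [Pi.mul_apply, gaussianPDF]
              rw [← mul_assoc, ← ENNReal.ofReal_mul (gaussianPDFReal_nonneg _ _ _), mul_comm (gaussianPDFReal 0 1 x)]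
              calc _ ≤ ENNReal.ofReal 1 * _ := by
                    gcongr; exact aux_pdf_le x
                _ = _ := by simp
          _ = ∫⁻ x, (Ioo (-1:ℝ) 1).indicator
                (fun y => ENNReal.ofReal (|y| ^ (δ - 1))) x := lintegral_sub_right_eq_self _ ρ
          _ = _ := lintegral_indicator measurableSet_Ioo _
          _ ≤ _ := aux_lint_rpow δ hδ
    _ = ENNReal.ofReal (A.toReal + 2 / δ) := by
        rw [ENNReal.ofReal_add (by positivity) (by positivity), ENNReal.ofReal_toReal hA]
    _ ≤ _ := by
        apply ENNReal.ofReal_le_ofReal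
        rw [add_div]
        gcongr
        rw [le_div_iff₀ hδ]
        nlinarith [ENNReal.toReal_nonneg (a := A)]

lemma aux_coeff (s : Multiset ℂ) (j : ℕ) :
    ‖((s.map (fun r => Polynomial.X - Polynomial.C r)).prod).coeff j‖
      ≤ (s.map (fun r => 1 + ‖r‖)).prod := by
  induction s using Multiset.induction_on generalizing j with
  | empty =>
    simp [Polynomial.coeff_one]
    split_ifs <;> simp
  | cons r s ih =>
    simp only [Multiset.map_cons, Multiset.prod_cons]
    rw [sub_mul, Polynomial.coeff_sub, Polynomial.coeff_C_mul]
    have h1 : ‖(Polynomial.X * (s.map (fun r => Polynomial.X - Polynomial.C r)).prod).coeff j‖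
        ≤ (s.map (fun r => 1 + ‖r‖)).prod := by
      cases j with
      | zero =>
        rw [Polynomial.coeff_X_mul_zero, norm_zero]
        exact (norm_nonneg _).trans (ih 0)
      | succ j => rw [Polynomial.coeff_X_mul]; exact ih j
    calc _ ≤ _ := norm_sub_le _ _
      _ ≤ (s.map (fun r => 1 + ‖r‖)).prod + ‖r‖ * (s.map (fun r => 1 + ‖r‖)).prod := by
        rw [norm_mul]
        gcongr
        exact ih j
      _ = _ := by ring

/-- product of n ≤ d nonneg numbers to the θ is ≤ 1 + sum of s-powers -/
lemma aux_prod (S : Multiset ℝ) (hS : ∀ a ∈ S, 0 ≤ a) (d : ℕ) (hd : S.card ≤ d) (θ s : ℝ)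
    (hθ : 0 ≤ θ) (hs : d * θ ≤ s) :
    S.prod ^ θ ≤ 1 + (S.map (fun a => a ^ s)).sum := by
  have hs0 : 0 ≤ s := le_trans (by positivity) hs
  -- there is A ≥ 1 with all a ≤ A and A ^ s ≤ RHS
  have hex : ∃ A : ℝ, 1 ≤ A ∧ (∀ a ∈ S, a ≤ A) ∧ A ^ s ≤ 1 + (S.map (fun a => a ^ s)).sum := by
    clear hd hs
    induction S using Multiset.induction_on with
    | empty => exact ⟨1, le_rfl, by simp, by simp⟩
    | cons a S ih =>
      obtain ⟨A, hA1, hA2, hA3⟩ := ih (fun b hb => hS b (Multiset.mem_cons_of_mem hb))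
      have ha := hS a (Multiset.mem_cons_self _ _)
      have hsum : 0 ≤ (S.map (fun a => a ^ s)).sum := by
        apply Multiset.sum_nonneg
        intro x hx
        obtain ⟨b, hb, rfl⟩ := Multiset.mem_map.1 hx
        exact Real.rpow_nonneg (hS b (Multiset.mem_cons_of_mem hb)) _
      rw [Multiset.map_cons, Multiset.sum_cons]
      have has : 0 ≤ a ^ s := Real.rpow_nonneg ha _
      rcases le_total a A with h | h
      · refine ⟨A, hA1, ?_, by linarith⟩
        intro b hb
        rcases Multiset.mem_cons.1 hb with rfl | hb
        · exact h
        · exact hA2 b hb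
      · refine ⟨a, hA1.trans h, ?_, by linarith⟩
        intro b hb
        rcases Multiset.mem_cons.1 hb with rfl | hb
        · exact le_rfl
        · exact (hA2 b hb).trans h
  obtain ⟨A, hA1, hA2, hA3⟩ := hex
  have hp : S.prod ≤ A ^ S.card := by
    clear hd hA3
    induction S using Multiset.induction_on with
    | empty => simp
    | cons a S ih =>
      rw [Multiset.prod_cons, Multiset.card_cons, pow_succ']
      have h1 := ih (fun b hb => hS b (Multiset.mem_cons_of_mem hb))
        (fun b hb => hA2 b (Multiset.mem_cons_of_mem hb))
      have h2 : 0 ≤ S.prod := Multiset.prod_nonneg (fun b hb => hS b (Multiset.mem_cons_of_mem hb))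
      exact mul_le_mul (hA2 a (Multiset.mem_cons_self _ _)) h1 h2 (by linarith)
  calc S.prod ^ θ ≤ (A ^ S.card) ^ θ := by
        apply Real.rpow_le_rpow (Multiset.prod_nonneg hS) hp hθ
    _ = A ^ (S.card * θ) := by
        rw [← Real.rpow_natCast, ← Real.rpow_mul (by linarith)]
    _ ≤ A ^ s := by
        apply Real.rpow_le_rpow_of_exponent_le hA1
        refine le_trans ?_ hs
        gcongr
    _ ≤ _ := hA3

/-- pointwise estimate -/
lemma aux_pt (p : Polynomial ℝ) (d : ℕ) (hd : p.natDegree ≤ d) (θ δ : ℝ) (hθ : 0 ≤ θ)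
    (hδ : 0 < δ) (hδ1 : δ ≤ 1) (hdθ : d * θ ≤ 1 - δ) (j : ℕ) (x : ℝ) (hx : p.eval x ≠ 0)
    (hre : ∀ r ∈ (p.map (algebraMap ℝ ℂ)).roots, x ≠ r.re) :
    |p.coeff j| ^ θ * |p.eval x| ^ (-θ) ≤ 1 + ((p.map (algebraMap ℝ ℂ)).roots.map
      (fun r => 1 + (1 + |x|) * |x - r.re| ^ (δ - 1))).sum := by
  set P := p.map (algebraMap ℝ ℂ) with hP
  have hsp := IsAlgClosed.splits P
  have hfac := hsp.eq_prod_roots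
  have hcard : P.roots.card ≤ d := by
    rw [← hsp.natDegree_eq_card_roots, hP, Polynomial.natDegree_map]; exact hd
  have hev : |p.eval x| = ‖P.leadingCoeff‖ * (P.roots.map (fun r => ‖(x:ℂ) - r‖)).prod := by
    have h1 : P.eval (x:ℂ) = ((p.eval x : ℝ) : ℂ) := by
      have := Polynomial.eval_map_algebraMap (B := ℂ) p (x:ℂ)
      rw [hP, this]
      exact (Polynomial.aeval_algebraMap_apply_eq_algebraMap_eval x p)
    have h2 : |p.eval x| = ‖P.eval (x:ℂ)‖ := by rw [h1, Complex.norm_real, Real.norm_eq_abs]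
    rw [h2]
    conv_lhs => rw [hfac]
    rw [Polynomial.eval_mul, Polynomial.eval_C, norm_mul, Polynomial.eval_multiset_prod]
    congr 1
    rw [Multiset.map_map]
    generalize P.roots = s
    induction s using Multiset.induction_on with
    | empty => simp
    | cons a s ih =>
      simp only [Multiset.map_cons, Multiset.prod_cons, norm_mul, ih]
      simp
  have hco : |p.coeff j| ≤ ‖P.leadingCoeff‖ * (P.roots.map (fun r => 1 + ‖r‖)).prod := by
    have h1 : |p.coeff j| = ‖P.coeff j‖ := by
      rw [hP, Polynomial.coeff_map]; simp
    rw [h1]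
    conv_lhs => rw [hfac]
    rw [Polynomial.coeff_C_mul, norm_mul]
    gcongr
    exact aux_coeff _ _
  have hev0 : 0 < |p.eval x| := abs_pos.2 hx
  have hlc : 0 < ‖P.leadingCoeff‖ := by
    rcases (norm_nonneg P.leadingCoeff).eq_or_lt with h | h
    · rw [hev, ← h, zero_mul] at hev0; exact absurd hev0 (lt_irrefl _)
    · exact h
  have hpr0 : 0 < (P.roots.map (fun r => ‖(x:ℂ) - r‖)).prod := by
    rw [hev] at hev0; exact (pos_iff_pos_of_mul_pos hev0).1 hlc
  have hratio : |p.coeff j| / |p.eval x| ≤ (P.roots.map (fun r => (1 + ‖r‖) / ‖(x:ℂ) - r‖)).prod := by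
    rw [Multiset.prod_map_div, hev, div_le_div_iff₀ (by positivity) hpr0]
    calc _ ≤ (‖P.leadingCoeff‖ * (P.roots.map (fun r => 1 + ‖r‖)).prod) * _ := by gcongr
      _ = _ := by ring
  have hprod := aux_prod (P.roots.map (fun r => (1 + ‖r‖) / ‖(x:ℂ) - r‖)) (by
    intro a ha
    obtain ⟨r, hr, rfl⟩ := Multiset.mem_map.1 ha
    positivity) d (by rwa [Multiset.card_map]) θ (1 - δ) hθ hdθ
  calc |p.coeff j| ^ θ * |p.eval x| ^ (-θ) = (|p.coeff j| / |p.eval x|) ^ θ := by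
        rw [Real.div_rpow (abs_nonneg _) (abs_nonneg _), Real.rpow_neg (abs_nonneg _)]; rfl
    _ ≤ _ := Real.rpow_le_rpow (by positivity) hratio hθ
    _ ≤ _ := hprod
    _ ≤ _ := by
      gcongr
      rw [Multiset.map_map]
      apply Multiset.sum_map_le_sum_map
      intro r hr
      have hne := hre r hr
      have hu : 0 < |x - r.re| := abs_pos.2 (sub_ne_zero.2 hne)
      have hu2 : |x - r.re| ≤ ‖(x:ℂ) - r‖ := by
        have := Complex.abs_re_le_norm ((x:ℂ) - r)
        simpa using this
      have hu3 : 0 < ‖(x:ℂ) - r‖ := hu.trans_le hu2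
      have h1 : (1 + ‖r‖) / ‖(x:ℂ) - r‖ ≤ 1 + (1 + |x|) / |x - r.re| := by
        have h2 : ‖r‖ ≤ |x| + ‖(x:ℂ) - r‖ := by
          have := norm_sub_le (x:ℂ) ((x:ℂ) - r)
          simpa using this
        calc (1 + ‖r‖) / ‖(x:ℂ) - r‖ ≤ (‖(x:ℂ) - r‖ + (1 + |x|)) / ‖(x:ℂ) - r‖ := by
              apply div_le_div_of_nonneg_right _ hu3.le; linarith
          _ = 1 + (1 + |x|) / ‖(x:ℂ) - r‖ := by rw [add_div, div_self hu3.ne']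
          _ ≤ _ := by gcongr
      simp only [Function.comp_apply]
      calc ((1 + ‖r‖) / ‖(x:ℂ) - r‖) ^ (1 - δ) ≤ (1 + (1 + |x|) / |x - r.re|) ^ (1 - δ) :=
            Real.rpow_le_rpow (by positivity) h1 (by linarith)
        _ ≤ 1 ^ (1 - δ) + ((1 + |x|) / |x - r.re|) ^ (1 - δ) :=
            Real.rpow_add_le_add_rpow zero_le_one (by positivity) (by linarith) (by linarith)
        _ = 1 + (1 + |x|) ^ (1 - δ) * |x - r.re| ^ (δ - 1) := by
            rw [Real.one_rpow, Real.div_rpow (by positivity) (by positivity), div_eq_mul_inv,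
              ← Real.rpow_neg (abs_nonneg _), neg_sub]
        _ ≤ _ := by
            gcongr
            calc (1 + |x|) ^ (1 - δ) ≤ (1 + |x|) ^ (1:ℝ) :=
                  Real.rpow_le_rpow_of_exponent_le (by linarith [abs_nonneg x]) (by linarith)
              _ = _ := Real.rpow_one _

lemma aux_ae_ne (S : Finset ℝ) : ∀ᵐ x ∂(gaussianReal 0 1), x ∉ S := by
  have := nullSingletonClass_gaussianReal (μ := 0) (v := 1) one_ne_zero
  rw [ae_iff]
  simp only [not_not]
  exact S.finite_toSet.measure_zero _

lemma aux_rpow_enorm (y θ : ℝ) (hy : y ≠ 0) : ‖y‖ₑ ^ θ = ENNReal.ofReal (|y| ^ θ) := by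
  rw [← ofReal_norm, Real.norm_eq_abs, ENNReal.ofReal_rpow_of_pos (abs_pos.2 hy)]

lemma neg_moment1 (d : ℕ) : ∃ C : ℝ, 1 ≤ C ∧ ∀ (p : Polynomial ℝ), p.natDegree ≤ d →
    ∀ θ δ : ℝ, 0 < θ → 0 < δ → δ ≤ 1 → d * θ ≤ 1 - δ → ∀ j : ℕ,
    ∫⁻ x, ‖p.eval x‖ₑ ^ (-θ) ∂(gaussianReal 0 1) ≤
      ENNReal.ofReal (C / δ) * ‖p.coeff j‖ₑ ^ (-θ) := by
  obtain ⟨C, hC, hsing⟩ := aux_sing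
  refine ⟨1 + d * (1 + C), by nlinarith [(Nat.cast_nonneg d : (0:ℝ) ≤ d)], ?_⟩
  intro p hd θ δ hθ hδ hδ1 hdθ j
  have hKpos : 0 < (1 + d * (1 + C)) / δ := by positivity
  by_cases hj : p.coeff j = 0
  · rw [hj, enorm_zero, ENNReal.zero_rpow_of_neg (by linarith), ENNReal.mul_top]
    · exact le_top
    · simpa using hKpos
  have hp0 : p ≠ 0 := by rintro rfl; simp at hj
  set R := (p.map (algebraMap ℝ ℂ)).roots with hR
  have hcard : R.card ≤ d := by
    rw [hR, ← (IsAlgClosed.splits _).natDegree_eq_card_roots, Polynomial.natDegree_map]; exact hd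
  have hae : ∀ᵐ x ∂(gaussianReal 0 1), ‖p.eval x‖ₑ ^ (-θ) ≤
      ‖p.coeff j‖ₑ ^ (-θ) * (1 + (R.map
      (fun r => 1 + ENNReal.ofReal ((1 + |x|) * |x - r.re| ^ (δ - 1)))).sum) := by
    filter_upwards [aux_ae_ne p.roots.toFinset, aux_ae_ne (R.map Complex.re).toFinset] with x h1 h2
    have hx : p.eval x ≠ 0 := by
      intro h; apply h1; simp [hp0, h]
    have hre : ∀ r ∈ R, x ≠ r.re := by
      intro r hr h; apply h2; rw [Multiset.mem_toFinset, Multiset.mem_map]; exact ⟨r, hr, h.symm⟩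
    have := aux_pt p d hd θ δ hθ.le hδ hδ1 hdθ j x hx hre
    rw [aux_rpow_enorm _ _ hx, aux_rpow_enorm _ _ hj]
    have hsumeq : (1 + (R.map
      (fun r => 1 + ENNReal.ofReal ((1 + |x|) * |x - r.re| ^ (δ - 1)))).sum) =
      ENNReal.ofReal (1 + (R.map (fun r => 1 + (1 + |x|) * |x - r.re| ^ (δ - 1))).sum) := by
      have haux : ∀ s : Multiset ℂ, 0 ≤ (s.map (fun r => 1 + (1 + |x|) * |x - r.re| ^ (δ - 1))).sum ∧
        (s.map (fun r => 1 + ENNReal.ofReal ((1 + |x|) * |x - r.re| ^ (δ - 1)))).sum =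
        ENNReal.ofReal ((s.map (fun r => 1 + (1 + |x|) * |x - r.re| ^ (δ - 1))).sum) := by
        intro s
        induction s using Multiset.induction_on with
        | empty => simp
        | cons a s ih =>
          simp only [Multiset.map_cons, Multiset.sum_cons]
          have h0 : 0 ≤ (1 + |x|) * |x - a.re| ^ (δ - 1) := by positivity
          refine ⟨by linarith [ih.1], ?_⟩
          rw [ih.2, ENNReal.ofReal_add (by positivity) ih.1, ENNReal.ofReal_add zero_le_one h0,
            ENNReal.ofReal_one]
      rw [(haux R).2, ENNReal.ofReal_add zero_le_one (haux R).1, ENNReal.ofReal_one]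
    rw [hsumeq, ← ENNReal.ofReal_mul (by positivity)]
    apply ENNReal.ofReal_le_ofReal
    have hjp : 0 < |p.coeff j| ^ θ := Real.rpow_pos_of_pos (abs_pos.2 hj) _
    rw [Real.rpow_neg (abs_nonneg (p.coeff j)), ← div_eq_inv_mul, le_div_iff₀ hjp, mul_comm]
    exact this
  have hsum : ∀ s : Multiset ℂ, Measurable (fun x : ℝ => (s.map
      (fun r => 1 + ENNReal.ofReal ((1 + |x|) * |x - r.re| ^ (δ - 1)))).sum) ∧
      ∫⁻ x, (s.map
      (fun r => 1 + ENNReal.ofReal ((1 + |x|) * |x - r.re| ^ (δ - 1)))).sum ∂(gaussianReal 0 1)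
      ≤ s.card * ENNReal.ofReal (1 + C / δ) := by
    intro s
    induction s using Multiset.induction_on with
    | empty => simp
    | cons a s ih =>
      simp only [Multiset.map_cons, Multiset.sum_cons, Multiset.card_cons]
      have hma : Measurable (fun x : ℝ => 1 + ENNReal.ofReal ((1 + |x|) * |x - a.re| ^ (δ - 1))) := by
        fun_prop
      refine ⟨hma.add ih.1, ?_⟩
      rw [lintegral_add_left hma, lintegral_add_left measurable_const]
      push_cast
      rw [add_mul, add_comm, one_mul]
      gcongr
      · exact ih.2
      · rw [ENNReal.ofReal_add zero_le_one (by positivity)]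
        simp only [lintegral_one, measure_univ, ENNReal.ofReal_one]
        gcongr
        exact hsing δ hδ hδ1 a.re
  calc _ ≤ _ := lintegral_mono_ae hae
    _ = ‖p.coeff j‖ₑ ^ (-θ) * (1 + ∫⁻ x, (R.map
      (fun r => 1 + ENNReal.ofReal ((1 + |x|) * |x - r.re| ^ (δ - 1)))).sum ∂(gaussianReal 0 1)) := by
        refine (lintegral_const_mul _ (measurable_const.add (hsum R).1)).trans ?_
        simp only [Pi.add_apply]
        rw [lintegral_add_left measurable_const]
        simp
    _ ≤ ‖p.coeff j‖ₑ ^ (-θ) * (1 + d * ENNReal.ofReal (1 + C / δ)) := by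
        gcongr
        refine (hsum R).2.trans ?_
        gcongr
    _ = ‖p.coeff j‖ₑ ^ (-θ) * ENNReal.ofReal (1 + d * (1 + C / δ)) := by
        rw [ENNReal.ofReal_add (p := 1) (q := d * (1 + C / δ)) zero_le_one (by positivity),
          ENNReal.ofReal_mul (by positivity)]
        simp
    _ ≤ ‖p.coeff j‖ₑ ^ (-θ) * ENNReal.ofReal ((1 + d * (1 + C)) / δ) := by
        gcongr
        rw [le_div_iff₀ hδ]
        have : (1 + d * (1 + C / δ)) * δ = δ + d * (δ + C) := by field_simp
        rw [this]
        gcongr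
    _ = _ := mul_comm _ _

lemma poisson (a b : ℝ) : Integrable (fun x : ℝ => |b| / ((x - a)^2 + b^2)) ∧
    ∫ x : ℝ, |b| / ((x - a)^2 + b^2) ≤ Real.pi := by
  by_cases hb : b = 0
  · subst hb; simp; exact Real.pi_pos.le
  have hfun : (fun x : ℝ => |b| / ((x - a)^2 + b^2)) =
      fun x => |b|⁻¹ * (1 + ((x - a) / b)^2)⁻¹ := by
    ext x
    have hb' : |b| ≠ 0 := abs_ne_zero.2 hb
    have h1 : (x - a)^2 + b^2 ≠ 0 := by positivity
    rw [div_pow, ← sq_abs b]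
    rw [← sq_abs b] at h1
    have h2 : 1 + (x-a)^2 / |b|^2 ≠ 0 := by positivity
    field_simp
    ring
  rw [hfun]
  have hi : Integrable (fun x : ℝ => (1 + ((x - a) / b)^2)⁻¹) :=
    ((integrable_inv_one_add_sq.comp_div hb).comp_sub_right a)
  refine ⟨hi.const_mul _, ?_⟩
  rw [integral_const_mul, integral_sub_right_eq_self (fun x => (1 + (x / b)^2)⁻¹) a,
    Measure.integral_comp_div (fun x => (1 + x^2)⁻¹) b, integral_univ_inv_one_add_sq]
  have hb' : |b| ≠ 0 := abs_ne_zero.2 hb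
  rw [smul_eq_mul, ← mul_assoc, inv_mul_cancel₀ hb', one_mul]

lemma arctan_var (p : Polynomial ℝ) (d : ℕ) (hd : p.natDegree ≤ d) (l : ℝ) (hl : 0 < l) :
    ∃ B : ℝ → ℝ, Integrable B ∧ ∫ x, B x ≤ d * Real.pi ∧
      ∀ x, l * |p.derivative.eval x| / ((p.eval x)^2 + l^2) ≤ B x := by
  set P : Polynomial ℂ := p.map (algebraMap ℝ ℂ) - Polynomial.C (Complex.I * l) with hP
  have hsp := IsAlgClosed.splits P
  have hcard : P.roots.card ≤ d := by
    rw [← hsp.natDegree_eq_card_roots]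
    refine le_trans (Polynomial.natDegree_sub_C).le ?_
    rw [Polynomial.natDegree_map]; exact hd
  have hsum : ∀ s : Multiset ℂ,
      Integrable (fun x : ℝ => (s.map (fun r => |r.im| / ((x - r.re)^2 + r.im^2))).sum) ∧
      ∫ x : ℝ, (s.map (fun r => |r.im| / ((x - r.re)^2 + r.im^2))).sum ≤ s.card * Real.pi := by
    intro s
    induction s using Multiset.induction_on with
    | empty => simp
    | cons a s ih =>
      simp only [Multiset.map_cons, Multiset.sum_cons, Multiset.card_cons]
      have h := poisson a.re a.im
      refine ⟨h.1.add ih.1, ?_⟩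
      rw [integral_add h.1 ih.1]
      push_cast
      linarith [h.2, ih.2]
  refine ⟨_, (hsum P.roots).1, (hsum P.roots).2.trans ?_, ?_⟩
  · have := Real.pi_pos; gcongr
  intro x
  have hev : ∀ r : Polynomial ℝ, (r.map (algebraMap ℝ ℂ)).eval (x:ℂ) = ((r.eval x : ℝ) : ℂ) := by
    intro r
    rw [Polynomial.eval_map_algebraMap]
    exact (Polynomial.aeval_algebraMap_apply_eq_algebraMap_eval x r)
  have h1 : P.eval (x:ℂ) = ((p.eval x : ℝ):ℂ) - Complex.I * l := by
    rw [hP, Polynomial.eval_sub, hev, Polynomial.eval_C]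
  have h2 : P.derivative.eval (x:ℂ) = ((p.derivative.eval x : ℝ):ℂ) := by
    rw [hP, Polynomial.derivative_sub, Polynomial.derivative_C, sub_zero, Polynomial.derivative_map, hev]
  have hne : P.eval (x:ℂ) ≠ 0 := by
    rw [h1]; intro h
    have := congrArg Complex.im h
    simp at this; linarith
  have hld := hsp.eval_derivative_div_eval_of_ne_zero hne
  rw [h1, h2] at hld
  have him := congrArg Complex.im hld
  have hlhs : ((((p.derivative.eval x : ℝ):ℂ)) / (((p.eval x : ℝ):ℂ) - Complex.I * l)).im
      = l * p.derivative.eval x / ((p.eval x)^2 + l^2) := by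
    rw [Complex.div_im]
    simp [Complex.normSq_apply]
    ring
  rw [hlhs] at him
  have habs : l * |p.derivative.eval x| / ((p.eval x)^2 + l^2)
      = |l * p.derivative.eval x / ((p.eval x)^2 + l^2)| := by
    rw [abs_div, abs_mul, abs_of_pos hl, abs_of_pos (by positivity : 0 < (p.eval x)^2 + l^2)]
  rw [habs, him]
  generalize P.roots = s
  induction s using Multiset.induction_on with
  | empty => simp
  | cons a s ih =>
    simp only [Multiset.map_cons, Multiset.sum_cons, Complex.add_im]
    refine (abs_add_le _ _).trans (add_le_add ?_ ih)
    rw [Complex.div_im]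
    simp [Complex.normSq_apply]
    rw [abs_div, ← sq, ← sq, abs_of_nonneg (by positivity : 0 ≤ (x - a.re)^2 + a.im^2), abs_neg]

lemma osc_A (m : ℕ) : ∃ C : ℝ, 0 < C ∧ ∀ q : Polynomial ℝ, q.natDegree ≤ m → ∀ l : ℝ, 0 < l →
    ‖∫ x, Complex.exp (Complex.I * ((q.eval x : ℝ) : ℂ)) ∂(gaussianReal 0 1)‖ ≤
      ∫ x, l^2 / ((q.derivative.eval x)^2 + l^2) ∂(gaussianReal 0 1) + C / l := by
  have hxint : Integrable (fun x : ℝ => gaussianPDFReal 0 1 x * |x|) := by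
    have h := ((memLp_id_gaussianReal (μ := 0) (v := 1) 1).integrable (by simp)).abs
    rw [gaussianReal_of_var_ne_zero 0 one_ne_zero] at h
    have := (integrable_withDensity_iff_integrable_smul' (measurable_gaussianPDF 0 1)
      (ae_of_all _ (fun x => gaussianPDF_lt_top))).1 h
    simpa [toReal_gaussianPDF] using this
  refine ⟨(∫ x : ℝ, gaussianPDFReal 0 1 x * |x|) + m * Real.pi + 1, ?_, ?_⟩
  · have : 0 ≤ ∫ x : ℝ, gaussianPDFReal 0 1 x * |x| :=
      integral_nonneg (fun x => mul_nonneg (gaussianPDFReal_nonneg _ _ _) (abs_nonneg _))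
    have := Real.pi_pos
    positivity
  intro q hq l hl
  set p := q.derivative with hp
  obtain ⟨B, hB, hBi, hBle⟩ := arctan_var p m
    ((Polynomial.natDegree_derivative_le q).trans (by omega)) l hl
  set φ := gaussianPDFReal 0 1 with hφ
  have hφ0 : ∀ x, 0 ≤ φ x := gaussianPDFReal_nonneg 0 1
  have hφ1 : ∀ x, φ x ≤ 1 := fun x => by
    have := aux_pdf_le x
    nlinarith [hφ0 x, abs_nonneg x]
  have hφi : Integrable φ := integrable_gaussianPDFReal 0 1
  have hφd : ∀ x, HasDerivAt φ (-x * φ x) x := by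
    intro x
    have h1 : HasDerivAt (fun x : ℝ => -(x - 0)^2 / (2 * ((1:NNReal):ℝ))) (-x) x := by
      have := ((((hasDerivAt_id x).sub_const 0).pow 2).neg).div_const (2 * ((1:NNReal):ℝ))
      refine this.congr_deriv ?_
      simp
      ring
    have h2 := (h1.exp).const_mul ((√(2 * Real.pi * ((1:NNReal):ℝ)))⁻¹)
    rw [hφ, gaussianPDFReal_def]
    refine h2.congr_deriv ?_
    ring
  have hφm : Continuous φ := continuous_iff_continuousAt.2 fun x => (hφd x).continuousAt
  have hD : ∀ x, 0 < (p.eval x)^2 + l^2 := fun x => by positivity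
  have hpd : ∀ x, HasDerivAt (fun x => p.eval x) (p.derivative.eval x) x := fun x => p.hasDerivAt x
  have hqd : ∀ x, HasDerivAt (fun x => q.eval x) (p.eval x) x := fun x => q.hasDerivAt x
  set w : ℝ → ℝ := fun x => φ x * (p.eval x / ((p.eval x)^2 + l^2)) with hw
  set w' : ℝ → ℝ := fun x => (-x * φ x) * (p.eval x / ((p.eval x)^2 + l^2)) +
    φ x * ((p.derivative.eval x * ((p.eval x)^2 + l^2) - p.eval x * (2 * p.eval x * p.derivative.eval x))
      / ((p.eval x)^2 + l^2)^2) with hw'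
  have hwd : ∀ x, HasDerivAt w (w' x) x := by
    intro x
    have h1 : HasDerivAt (fun x => (p.eval x)^2 + l^2) (2 * p.eval x * p.derivative.eval x) x := by
      have := ((hpd x).pow 2).add_const (l^2)
      refine this.congr_deriv ?_
      ring
    exact (hφd x).mul ((hpd x).div h1 (hD x).ne')
  have hpl : ∀ x, |p.eval x / ((p.eval x)^2 + l^2)| ≤ 1 / l := by
    intro x
    rw [abs_div, abs_of_pos (hD x), div_le_div_iff₀ (hD x) hl, ← sq_abs (p.eval x)]
    nlinarith [sq_nonneg (|p.eval x| - l), sq_nonneg (|p.eval x|), abs_nonneg (p.eval x), mul_nonneg (abs_nonneg (p.eval x)) hl.le]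
  have hw'le : ∀ x, |w' x| ≤ (φ x * |x| + B x) / l := by
    intro x
    rw [add_div]
    refine (abs_add_le _ _).trans (add_le_add ?_ ?_)
    · rw [abs_mul, abs_mul, abs_neg, abs_of_nonneg (hφ0 x), mul_comm |x|]
      calc _ ≤ φ x * |x| * (1 / l) := by
            have := hφ0 x
            gcongr; exact hpl x
        _ = _ := by ring
    · rw [abs_mul, abs_of_nonneg (hφ0 x), abs_div, abs_of_pos (by have := hD x; positivity : 0 < ((p.eval x)^2 + l^2)^2)]
      have e1 : |p.derivative.eval x * ((p.eval x)^2 + l^2) - p.eval x * (2 * p.eval x * p.derivative.eval x)|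
          ≤ |p.derivative.eval x| * ((p.eval x)^2 + l^2) := by
        have : p.derivative.eval x * ((p.eval x)^2 + l^2) - p.eval x * (2 * p.eval x * p.derivative.eval x)
          = p.derivative.eval x * (l^2 - (p.eval x)^2) := by ring
        rw [this, abs_mul]
        gcongr
        rw [abs_le]; constructor <;> nlinarith [sq_nonneg (p.eval x), sq_nonneg l]
      have e2 : |p.derivative.eval x * ((p.eval x)^2 + l^2) - p.eval x * (2 * p.eval x * p.derivative.eval x)| / ((p.eval x)^2 + l^2)^2 ≤ B x / l := by
        calc _ ≤ |p.derivative.eval x| * ((p.eval x)^2 + l^2) / ((p.eval x)^2 + l^2)^2 := by gcongr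
          _ = (l * |p.derivative.eval x| / ((p.eval x)^2 + l^2)) / l := by
              have := (hD x).ne'
              field_simp
          _ ≤ _ := by gcongr; exact hBle x
      exact (mul_le_mul (hφ1 x) e2 (by positivity) zero_le_one).trans_eq (one_mul _)
  have hpc : Continuous (fun x => p.eval x) := p.continuous
  have hqc : Continuous (fun x => q.eval x) := q.continuous
  have hp'c : Continuous (fun x => p.derivative.eval x) := p.derivative.continuous
  have hwc : Continuous w := by
    apply hφm.mul (hpc.div (by fun_prop) (fun x => (hD x).ne'))
  have hw'c : Continuous w' := by
    apply Continuous.add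
    · exact ((continuous_neg).mul hφm).mul (hpc.div (by fun_prop) (fun x => (hD x).ne'))
    · exact hφm.mul (Continuous.div (by fun_prop) (by fun_prop) (fun x => (pow_pos (hD x) 2).ne'))
  set u : ℝ → ℂ := fun x => Complex.exp (Complex.I * ((q.eval x : ℝ) : ℂ)) with hu
  have hun : ∀ x, ‖u x‖ = 1 := fun x => by
    rw [hu]; simp only []; rw [mul_comm, Complex.norm_exp_ofReal_mul_I]
  have huc : Continuous u := by rw [hu]; fun_prop
  have hud : ∀ x, HasDerivAt u (u x * (Complex.I * ((p.eval x : ℝ):ℂ))) x := by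
    intro x
    exact (((hqd x).ofReal_comp).const_mul Complex.I).cexp
  have hdom : Integrable (fun x => (φ x * |x| + B x) / l) := (hxint.add hB).div_const l
  have i1 : Integrable (fun x => u x * ((w' x : ℝ) : ℂ)) := by
    refine hdom.mono' (by fun_prop) (ae_of_all _ fun x => ?_)
    rw [norm_mul, hun, one_mul, Complex.norm_real]; exact hw'le x
  have i2 : Integrable (fun x => (u x * (Complex.I * ((p.eval x : ℝ):ℂ))) * ((w x : ℝ) : ℂ)) := by
    refine hφi.mono' (by fun_prop) (ae_of_all _ fun x => ?_)
    rw [norm_mul, norm_mul, norm_mul, hun, one_mul, Complex.norm_I, one_mul, Complex.norm_real, Complex.norm_real,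
      ← norm_mul, Real.norm_eq_abs]
    have : p.eval x * w x = φ x * ((p.eval x)^2 / ((p.eval x)^2 + l^2)) := by rw [hw]; ring
    rw [this, abs_of_nonneg (mul_nonneg (hφ0 x) (by have := hD x; positivity))]
    have h2 : (p.eval x)^2 / ((p.eval x)^2 + l^2) ≤ 1 := by
      rw [div_le_one (hD x)]; nlinarith [sq_nonneg l]
    calc _ ≤ φ x * 1 := by have := hφ0 x; gcongr
      _ = _ := mul_one _
  have i3 : Integrable (fun x => u x * ((w x : ℝ) : ℂ)) := by
    refine (hφi.mul_const (1 / l)).mono' (by fun_prop) (ae_of_all _ fun x => ?_)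
    rw [norm_mul, hun, one_mul, Complex.norm_real, Real.norm_eq_abs, hw]
    simp only []
    rw [abs_mul, abs_of_nonneg (hφ0 x)]
    have := hφ0 x
    gcongr
    exact hpl x
  have ibp := integral_mul_deriv_eq_deriv_mul_of_integrable (u := u) (v := fun x => ((w x : ℝ):ℂ))
    (u' := fun x => u x * (Complex.I * ((p.eval x : ℝ):ℂ))) (v' := fun x => ((w' x : ℝ):ℂ))
    (fun x _ => hud x) (fun x _ => (hwd x).ofReal_comp) i1 i2 i3
  have i4 : Integrable (fun x => φ x * (l^2 / ((p.eval x)^2 + l^2))) := by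
    refine hφi.mono' ?_ (ae_of_all _ fun x => ?_)
    · exact (hφm.mul (continuous_const.div (by fun_prop) (fun x => (hD x).ne'))).aestronglyMeasurable
    · rw [Real.norm_eq_abs, abs_of_nonneg (mul_nonneg (hφ0 x) (by have := hD x; positivity))]
      have h2 : l^2 / ((p.eval x)^2 + l^2) ≤ 1 := by
        rw [div_le_one (hD x)]; nlinarith [sq_nonneg (p.eval x)]
      calc _ ≤ φ x * 1 := by have := hφ0 x; gcongr
        _ = _ := mul_one _
  have i5 : Integrable (fun x => u x * ((φ x * (l^2 / ((p.eval x)^2 + l^2)) : ℝ) : ℂ)) := by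
    refine i4.mono' ?_ (ae_of_all _ fun x => ?_)
    · exact huc.aestronglyMeasurable.mul (Complex.continuous_ofReal.comp_aestronglyMeasurable i4.1)
    · rw [norm_mul, hun, one_mul, Complex.norm_real, Real.norm_eq_abs, abs_of_nonneg (mul_nonneg (hφ0 x) (by have := hD x; positivity))]
  have hsplit : ∫ x, u x ∂(gaussianReal 0 1) =
      (∫ x, u x * ((φ x * (l^2 / ((p.eval x)^2 + l^2)) : ℝ) : ℂ)) +
      (-Complex.I) * ∫ x, (u x * (Complex.I * ((p.eval x : ℝ):ℂ))) * ((w x : ℝ) : ℂ) := by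
    rw [integral_gaussianReal_eq_integral_smul one_ne_zero, ← integral_const_mul,
      ← integral_add i5 (i2.const_mul _)]
    congr 1; ext x
    have hkey : φ x = φ x * (l^2 / ((p.eval x)^2 + l^2)) + p.eval x * w x := by
      rw [hw]; have := (hD x).ne'; field_simp; ring
    rw [Complex.real_smul, ← hφ]
    have e : ((φ x : ℝ) : ℂ) = ((φ x * (l^2 / ((p.eval x)^2 + l^2)) : ℝ) : ℂ) + ((p.eval x : ℝ):ℂ) * ((w x : ℝ):ℂ) := by
      rw [← Complex.ofReal_mul, ← Complex.ofReal_add, ← hkey]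
    rw [e]
    linear_combination (u x * ((p.eval x : ℝ):ℂ) * ((w x : ℝ):ℂ)) * Complex.I_mul_I
  rw [hsplit]
  refine (norm_add_le _ _).trans (add_le_add ?_ ?_)
  · rw [integral_gaussianReal_eq_integral_smul one_ne_zero]
    refine (norm_integral_le_of_norm_le i4 (ae_of_all _ fun x => ?_))
    rw [norm_mul, hun, one_mul, Complex.norm_real, Real.norm_eq_abs, abs_of_nonneg (mul_nonneg (hφ0 x) (by have := hD x; positivity))]
    exact le_rfl
  · have : ∫ x, (u x * (Complex.I * ((p.eval x : ℝ):ℂ))) * ((w x : ℝ) : ℂ) = - ∫ x, u x * ((w' x : ℝ):ℂ) := by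
      rw [ibp, neg_neg]
    rw [this, norm_mul, norm_neg, norm_neg, Complex.norm_I, one_mul]
    calc _ ≤ ∫ x, (φ x * |x| + B x) / l := by
          refine norm_integral_le_of_norm_le hdom (ae_of_all _ fun x => ?_)
          rw [norm_mul, hun, one_mul, Complex.norm_real]; exact hw'le x
      _ = ((∫ x, φ x * |x|) + ∫ x, B x) / l := by
          rw [integral_div, integral_add hxint hB]
      _ ≤ _ := by
          apply div_le_div_of_nonneg_right _ hl.le; linarith

lemma aux_pt2 (l y θ : ℝ) (hl : 0 < l) (hθ : 0 < θ) (hθ2 : θ ≤ 2) :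
    ENNReal.ofReal (l^2 / (y^2 + l^2)) ≤ ENNReal.ofReal (l ^ θ) * ‖y‖ₑ ^ (-θ) := by
  by_cases hy : y = 0
  · rw [hy, enorm_zero, ENNReal.zero_rpow_of_neg (by linarith), ENNReal.mul_top]
    · exact le_top
    · simpa using Real.rpow_pos_of_pos hl θ
  rw [aux_rpow_enorm _ _ hy, ← ENNReal.ofReal_mul (by positivity)]
  apply ENNReal.ofReal_le_ofReal
  have hy0 : 0 < |y| := abs_pos.2 hy
  have e : l ^ θ * |y| ^ (-θ) = (l / |y|) ^ θ := by
    rw [Real.div_rpow hl.le (abs_nonneg _), Real.rpow_neg (abs_nonneg _)]; rfl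
  rw [e]
  rcases le_total (l / |y|) 1 with h | h
  · calc l^2 / (y^2 + l^2) ≤ l^2 / y^2 := by gcongr; nlinarith [sq_nonneg l]
      _ = (l / |y|) ^ (2:ℝ) := by rw [Real.rpow_two, div_pow, sq_abs]
      _ ≤ _ := Real.rpow_le_rpow_of_exponent_ge (by positivity) h hθ2
  · calc l^2 / (y^2 + l^2) ≤ 1 := by
          rw [div_le_one (by positivity)]; nlinarith [sq_nonneg y]
      _ ≤ _ := Real.one_le_rpow h hθ.le

lemma osc_norm_le_one (f : ℝ → ℝ) :
    ‖∫ x, Complex.exp (Complex.I * ((f x : ℝ) : ℂ)) ∂(gaussianReal 0 1)‖ ≤ 1 := by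
  have := norm_integral_le_of_norm_le_const (μ := gaussianReal 0 1) (C := 1)
    (f := fun x => Complex.exp (Complex.I * ((f x : ℝ) : ℂ))) (ae_of_all _ fun x => by
      rw [mul_comm, Complex.norm_exp_ofReal_mul_I])
  simpa using this

lemma osc_lin (a b : ℝ) (ha : 0 < |a|) :
    ‖∫ x, Complex.exp (Complex.I * ((b + a * x : ℝ) : ℂ)) ∂(gaussianReal 0 1)‖ ≤ 1 / |a| := by
  have e : ∫ x, Complex.exp (Complex.I * ((b + a * x : ℝ) : ℂ)) ∂(gaussianReal 0 1)
      = Complex.exp (b * Complex.I) * charFun (gaussianReal 0 1) a := by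
    rw [charFun_apply_real, ← integral_const_mul]
    congr 1; ext x
    rw [← Complex.exp_add]; congr 1; push_cast; ring
  rw [e, norm_mul, Complex.norm_exp_ofReal_mul_I, one_mul, charFun_gaussianReal, Complex.norm_exp]
  have : ((a:ℂ) * ((0:ℝ):ℂ) * Complex.I - ((1:NNReal):ℝ) * (a:ℂ)^2 / 2).re = -(a^2/2) := by
    have : ((a:ℂ) * ((0:ℝ):ℂ) * Complex.I - ((1:NNReal):ℝ) * (a:ℂ)^2 / 2) = ((-(a^2/2) : ℝ) : ℂ) := by
      push_cast; simp
    rw [this, Complex.ofReal_re]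
  rw [this, Real.exp_neg, inv_eq_one_div]
  apply one_div_le_one_div_of_le ha
  have := Real.add_one_le_exp (a^2/2)
  nlinarith [sq_abs a, sq_nonneg (|a| - 1)]

lemma osc1 (m : ℕ) (hm : 1 ≤ m) : ∃ C : ℝ, 1 ≤ C ∧ ∀ q : Polynomial ℝ, q.natDegree ≤ m →
    ∀ δ : ℝ, 0 < δ → δ < 1 → ∀ j : ℕ, 1 ≤ j →
    ‖∫ x, Complex.exp (Complex.I * ((q.eval x : ℝ) : ℂ)) ∂(gaussianReal 0 1)‖ₑ ≤
      ENNReal.ofReal (C / δ) * ‖q.coeff j‖ₑ ^ (-((1 - δ) / m)) := by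
  obtain ⟨C1, hC1, h1⟩ := neg_moment1 (m - 1)
  obtain ⟨C2, hC2, h2⟩ := osc_A m
  refine ⟨C1 + C2, by linarith, ?_⟩
  intro q hq δ hδ hδ1 j hj
  set θ := (1 - δ) / m with hθ
  have hm0 : (0:ℝ) < m := by exact_mod_cast hm
  have hθ0 : 0 < θ := div_pos (by linarith) hm0
  have hCδ : 1 ≤ (C1 + C2) / δ := by rw [le_div_iff₀ hδ]; linarith
  rcases le_or_gt |q.coeff j| 1 with ha | ha
  · have e1 : ‖∫ x, Complex.exp (Complex.I * ((q.eval x : ℝ) : ℂ)) ∂(gaussianReal 0 1)‖ₑ ≤ 1 := by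
      rw [← ofReal_norm, ← ENNReal.ofReal_one]
      exact ENNReal.ofReal_le_ofReal (osc_norm_le_one _)
    have e2 : (1:ENNReal) ≤ ‖q.coeff j‖ₑ ^ (-θ) := by
      rw [ENNReal.rpow_neg]
      apply ENNReal.one_le_inv.2
      apply ENNReal.rpow_le_one _ hθ0.le
      rw [← ofReal_norm, ← ENNReal.ofReal_one]
      exact ENNReal.ofReal_le_ofReal ha
    refine e1.trans ?_
    have e3 : (1:ENNReal) ≤ ENNReal.ofReal ((C1 + C2) / δ) := by
      rw [← ENNReal.ofReal_one]; exact ENNReal.ofReal_le_ofReal hCδ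
    exact one_le_mul e3 e2
  have hane : q.coeff j ≠ 0 := by intro h; rw [h] at ha; simp at ha; linarith
  rw [aux_rpow_enorm _ _ hane, ← ENNReal.ofReal_mul (by positivity), ← ofReal_norm]
  apply ENNReal.ofReal_le_ofReal
  have hjm : j ≤ m := by
    by_contra hc
    exact hane (Polynomial.coeff_eq_zero_of_natDegree_lt (by omega))
  rcases Nat.eq_or_lt_of_le hm with hm1 | hm2
  · have hj1 : j = 1 := by omega
    subst hj1
    have hev : ∀ x, q.eval x = q.coeff 0 + q.coeff 1 * x := by
      intro x
      conv_lhs => rw [Polynomial.eq_X_add_C_of_natDegree_le_one (by omega : q.natDegree ≤ 1)]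
      simp; ring
    simp only [hev]
    calc _ ≤ 1 / |q.coeff 1| := osc_lin _ _ (by linarith)
      _ = 1 * |q.coeff 1| ^ (-1:ℝ) := by rw [Real.rpow_neg_one, one_mul, one_div]
      _ ≤ _ := by
        gcongr
        · exact ha.le
        · rw [hθ, ← hm1]; simp; linarith
  set p := q.derivative with hp
  set h := |p.coeff (j-1)| with hh
  have hah : |q.coeff j| ≤ h := by
    rw [hh, hp, Polynomial.coeff_derivative, Nat.sub_add_cancel hj, abs_mul]
    have : (1:ℝ) ≤ |((j-1:ℕ):ℝ) + 1| := by
      rw [abs_of_nonneg (by positivity)]; linarith [(Nat.cast_nonneg (j-1) : (0:ℝ) ≤ ((j-1:ℕ):ℝ))]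
    nlinarith [abs_nonneg (q.coeff j)]
  have hh1 : 1 < h := ha.trans_le hah
  have hh0 : 0 < h := by linarith
  have hm1' : (0:ℝ) < (m:ℝ) - 1 := by
    have : (1:ℝ) < m := by exact_mod_cast hm2
    linarith
  have hm1'' : (1:ℝ) ≤ (m:ℝ) - 1 := by
    have : (2:ℝ) ≤ m := by exact_mod_cast hm2
    linarith
  set θ' := (1 - δ) / ((m:ℝ) - 1) with hθ'
  have hθ'0 : 0 < θ' := div_pos (by linarith) hm1'
  have hθ'2 : θ' ≤ 2 := by rw [hθ', div_le_iff₀ hm1']; nlinarith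
  set l := h ^ (1 / (m:ℝ)) with hl
  have hl0 : 0 < l := Real.rpow_pos_of_pos hh0 _
  have hpc0 : p.coeff (j-1) ≠ 0 := by
    intro h0; rw [hh, h0] at hh0; simp at hh0
  have hcont : Continuous (fun x => l^2 / ((p.eval x)^2 + l^2)) :=
    continuous_const.div ((p.continuous.pow 2).add continuous_const) (fun x => by positivity)
  have hI : ∫ x, l^2 / ((p.eval x)^2 + l^2) ∂(gaussianReal 0 1) ≤ C1 / δ * h ^ (-θ) := by
    have hb : ENNReal.ofReal (∫ x, l^2 / ((p.eval x)^2 + l^2) ∂(gaussianReal 0 1)) ≤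
        ENNReal.ofReal (C1 / δ * h ^ (-θ)) := by
      rw [ofReal_integral_eq_lintegral_ofReal]
      · calc _ ≤ ∫⁻ x, ENNReal.ofReal (l ^ θ') * ‖p.eval x‖ₑ ^ (-θ') ∂(gaussianReal 0 1) :=
              lintegral_mono fun x => aux_pt2 l (p.eval x) θ' hl0 hθ'0 hθ'2
          _ = ENNReal.ofReal (l ^ θ') * ∫⁻ x, ‖p.eval x‖ₑ ^ (-θ') ∂(gaussianReal 0 1) := by
              rw [lintegral_const_mul]
              have := p.continuous.measurable
              fun_prop
          _ ≤ ENNReal.ofReal (l ^ θ') * (ENNReal.ofReal (C1 / δ) * ‖p.coeff (j-1)‖ₑ ^ (-θ')) := by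
              gcongr
              refine h1 p ((Polynomial.natDegree_derivative_le q).trans (by omega)) θ' δ hθ'0 hδ hδ1.le ?_ (j-1)
              rw [Nat.cast_sub hm, hθ', Nat.cast_one, mul_div_cancel₀ _ hm1'.ne']
          _ = ENNReal.ofReal (C1 / δ * h ^ (-θ)) := by
              rw [aux_rpow_enorm _ _ hpc0, ← ENNReal.ofReal_mul (by positivity), ← ENNReal.ofReal_mul (by positivity)]
              congr 1
              rw [← hh, hl, ← Real.rpow_mul hh0.le]
              have : h ^ (1 / (m:ℝ) * θ') * h ^ (-θ') = h ^ (-θ) := by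
                rw [← Real.rpow_add hh0]
                congr 1
                rw [hθ, hθ']; field_simp; ring
              rw [← this]; ring
      · refine (integrable_const (1:ℝ)).mono' hcont.aestronglyMeasurable (ae_of_all _ fun x => ?_)
        rw [Real.norm_eq_abs, abs_of_nonneg (by positivity), div_le_one (by positivity)]
        nlinarith [sq_nonneg (p.eval x)]
      · exact ae_of_all _ fun x => by simp only [Pi.zero_apply]; positivity
    exact (ENNReal.ofReal_le_ofReal_iff (by positivity)).1 hb
  have hl2 : C2 / l ≤ C2 / δ * h ^ (-θ) := by
    have : l⁻¹ ≤ h ^ (-θ) := by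
      rw [hl, ← Real.rpow_neg hh0.le]
      apply Real.rpow_le_rpow_of_exponent_le hh1.le
      rw [hθ]; gcongr; linarith
    calc C2 / l = C2 * l⁻¹ := rfl
      _ ≤ C2 / δ * h ^ (-θ) := by
        gcongr
        rw [le_div_iff₀ hδ]; nlinarith
  calc _ ≤ _ := h2 q hq l hl0
    _ ≤ C1 / δ * h ^ (-θ) + C2 / δ * h ^ (-θ) := add_le_add hI hl2
    _ = (C1 + C2) / δ * h ^ (-θ) := by ring
    _ ≤ _ := mul_le_mul_of_nonneg_left (Real.rpow_le_rpow_of_nonpos (lt_trans zero_lt_one ha) hah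
        (neg_nonpos.2 hθ0.le)) (by positivity)

noncomputable def Fsum {k m : ℕ} (α : (Fin k → Fin (m + 1)) → ℝ) (z : Fin k → ℝ) : ℝ :=
  ∑ p : Fin k → Fin (m + 1), α p * ∏ i, z i ^ (p i : ℕ)

lemma Fsum_continuous {k m : ℕ} (α : (Fin k → Fin (m + 1)) → ℝ) : Continuous (Fsum α) := by
  unfold Fsum; fun_prop

lemma Fsum_cons {k m : ℕ} (α : (Fin (k+1) → Fin (m + 1)) → ℝ) (x : ℝ) (z : Fin k → ℝ) :
    Fsum α (Fin.cons x z : Fin (k+1) → ℝ) =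
      ∑ i : Fin (m+1), x ^ (i:ℕ) * Fsum (fun p => α (Fin.cons i p)) z := by
  unfold Fsum
  rw [← (Fin.consEquiv (fun _ => Fin (m+1))).sum_comp, Fintype.sum_prod_type]
  refine Finset.sum_congr rfl fun i _ => ?_
  rw [Finset.mul_sum]
  refine Finset.sum_congr rfl fun p _ => ?_
  simp [Fin.prod_univ_succ, Fin.consEquiv]
  ring

noncomputable def qpoly {k m : ℕ} (α : (Fin (k+1) → Fin (m + 1)) → ℝ) (a : ℝ) (z : Fin k → ℝ) :
    Polynomial ℝ :=
  ∑ i : Fin (m+1), Polynomial.C (Fsum (fun p => α (Fin.cons i p)) z) *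
    (Polynomial.X + Polynomial.C a) ^ (i:ℕ)

lemma qpoly_eval {k m : ℕ} (α : (Fin (k+1) → Fin (m + 1)) → ℝ) (a : ℝ) (z : Fin k → ℝ) (x : ℝ) :
    (qpoly α a z).eval x = Fsum α (Fin.cons (x + a) z : Fin (k+1) → ℝ) := by
  rw [Fsum_cons, qpoly, Polynomial.eval_finsetSum]
  refine Finset.sum_congr rfl fun i _ => ?_
  simp; ring

lemma qpoly_natDegree {k m : ℕ} (α : (Fin (k+1) → Fin (m + 1)) → ℝ) (a : ℝ) (z : Fin k → ℝ) :
    (qpoly α a z).natDegree ≤ m := by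
  apply Polynomial.natDegree_sum_le_of_forall_le
  intro i _
  refine (Polynomial.natDegree_C_mul_le _ _).trans ?_
  refine Polynomial.natDegree_pow_le.trans ?_
  rw [Polynomial.natDegree_X_add_C]
  omega

noncomputable def bcoef {k m : ℕ} (α : (Fin (k+1) → Fin (m + 1)) → ℝ) (a : ℝ) (j : ℕ)
    (p : Fin k → Fin (m+1)) : ℝ :=
  ∑ i : Fin (m+1), α (Fin.cons i p) * (a ^ ((i:ℕ) - j) * ((i:ℕ).choose j : ℝ))

lemma qpoly_coeff {k m : ℕ} (α : (Fin (k+1) → Fin (m + 1)) → ℝ) (a : ℝ) (z : Fin k → ℝ) (j : ℕ) :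
    (qpoly α a z).coeff j = Fsum (bcoef α a j) z := by
  rw [qpoly, Polynomial.finsetSum_coeff]
  simp only [Polynomial.coeff_C_mul, Polynomial.coeff_X_add_C_pow, Fsum, bcoef, Finset.sum_mul]
  rw [Finset.sum_comm]
  refine Finset.sum_congr rfl fun i _ => ?_
  refine Finset.sum_congr rfl fun p _ => ?_
  ring

lemma sum_cons_nat {k m : ℕ} (i : Fin (m+1)) (p : Fin k → Fin (m+1)) :
    ∑ l, (((Fin.cons i p : Fin (k+1) → Fin (m+1)) l : Fin (m+1)) : ℕ) = i + ∑ l, (p l : ℕ) := by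
  rw [Fin.sum_univ_succ]; simp

lemma bcoef_deg {k m M : ℕ} (α : (Fin (k+1) → Fin (m + 1)) → ℝ) (a : ℝ) (j : ℕ)
    (hα : ∀ p, α p ≠ 0 → ∑ i, (p i : ℕ) ≤ M) (p : Fin k → Fin (m+1)) (hp : bcoef α a j p ≠ 0) :
    j + ∑ i, (p i : ℕ) ≤ M := by
  obtain ⟨i, _, hi⟩ := Finset.exists_ne_zero_of_sum_ne_zero hp
  have h1 := hα _ (left_ne_zero_of_mul hi)
  rw [sum_cons_nat] at h1
  have h2 : j ≤ (i:ℕ) := by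
    by_contra hc
    apply right_ne_zero_of_mul (right_ne_zero_of_mul hi)
    rw [Nat.choose_eq_zero_of_lt (by omega)]; simp
  omega

lemma bcoef_top {k m M : ℕ} (α : (Fin (k+1) → Fin (m + 1)) → ℝ) (a : ℝ)
    (hα : ∀ p, α p ≠ 0 → ∑ i, (p i : ℕ) ≤ M) (j : Fin (m+1)) (p : Fin k → Fin (m+1))
    (hp : (j:ℕ) + ∑ i, (p i : ℕ) = M) :
    bcoef α a j p = α (Fin.cons j p) := by
  rw [bcoef, Finset.sum_eq_single j]
  · simp
  · intro i _ hij
    rcases lt_or_gt_of_ne hij with h | h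
    · rw [Nat.choose_eq_zero_of_lt (by exact_mod_cast h)]; simp
    · have : α (Fin.cons i p) = 0 := by
        by_contra hc
        have h1 := hα _ hc
        rw [sum_cons_nat] at h1
        have : (j:ℕ) < i := h
        omega
      rw [this, zero_mul]
  · simp

noncomputable abbrev gam (k : ℕ) : Measure (Fin k → ℝ) := Measure.pi fun _ : Fin k => gaussianReal 0 1

lemma mp_succ (k : ℕ) : MeasurePreserving
    (fun w : ℝ × (Fin k → ℝ) => (Fin.cons w.1 w.2 : Fin (k+1) → ℝ))
    ((gaussianReal 0 1).prod (gam k)) (gam (k+1)) := by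
  have := (measurePreserving_piFinSuccAbove (fun _ : Fin (k+1) => gaussianReal 0 1) 0).symm
  have e : (fun w : ℝ × (Fin k → ℝ) => (Fin.cons w.1 w.2 : Fin (k+1) → ℝ)) =
      ⇑(MeasurableEquiv.piFinSuccAbove (fun _ : Fin (k+1) => ℝ) 0).symm := by
    funext w
    ext i
    refine Fin.cases ?_ (fun i => ?_) i <;> simp [MeasurableEquiv.piFinSuccAbove]
  rw [e]
  exact this

lemma lint_succ (k : ℕ) (g : (Fin (k+1) → ℝ) → ENNReal) (hg : Measurable g) :
    ∫⁻ z, g z ∂(gam (k+1)) = ∫⁻ z, ∫⁻ x, g (Fin.cons x z) ∂(gaussianReal 0 1) ∂(gam k) := by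
  rw [← (mp_succ k).lintegral_comp hg, lintegral_prod_symm']
  exact hg.comp (mp_succ k).measurable

lemma int_succ (k : ℕ) (g : (Fin (k+1) → ℝ) → ℂ) (hg : Continuous g) (hb : ∀ z, ‖g z‖ ≤ 1) :
    ∫ z, g z ∂(gam (k+1)) = ∫ z, ∫ x, g (Fin.cons x z) ∂(gaussianReal 0 1) ∂(gam k) ∧
    ∫ z, g z ∂(gam (k+1)) = ∫ x, ∫ z, g (Fin.cons x z) ∂(gam k) ∂(gaussianReal 0 1) := by
  have hm := (mp_succ k).measurable
  have hi : Integrable (fun w : ℝ × (Fin k → ℝ) => g (Fin.cons w.1 w.2))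
      ((gaussianReal 0 1).prod (gam k)) := by
    refine (integrable_const (1:ℝ)).mono' ?_ (ae_of_all _ fun w => hb _)
    exact (hg.measurable.comp hm).aestronglyMeasurable
  have e : ∫ z, g z ∂(gam (k+1)) = ∫ w : ℝ × (Fin k → ℝ), g (Fin.cons w.1 w.2)
      ∂((gaussianReal 0 1).prod (gam k)) := by
    rw [← (mp_succ k).map_eq, integral_map hm.aemeasurable hg.aestronglyMeasurable]
  rw [e]
  exact ⟨integral_prod_symm _ hi, integral_prod _ hi⟩

lemma cons_add {k : ℕ} (x : ℝ) (z : Fin k → ℝ) (a : Fin (k+1) → ℝ) :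
    (fun i => (Fin.cons x z : Fin (k+1) → ℝ) i + a i) =
      (Fin.cons (x + a 0) (fun i => z i + a i.succ) : Fin (k+1) → ℝ) := by
  ext i
  refine Fin.cases ?_ (fun i => ?_) i <;> simp

lemma neg_multi (m : ℕ) (hm : 1 ≤ m) : ∃ C : ℝ, 1 ≤ C ∧ ∀ (δ : ℝ), 0 < δ → δ < 1 →
    ∀ (k M : ℕ) (α : (Fin k → Fin (m + 1)) → ℝ), (∀ p, α p ≠ 0 → ∑ i, (p i : ℕ) ≤ M) →
    ∀ p₀ : Fin k → Fin (m+1), ∑ i, (p₀ i : ℕ) = M → ∀ a : Fin k → ℝ,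
    ∫⁻ z, ‖Fsum α (fun i => z i + a i)‖ₑ ^ (-((1 - δ) / m)) ∂(gam k) ≤
      ENNReal.ofReal (C / δ) ^ k * ‖α p₀‖ₑ ^ (-((1 - δ) / m)) := by
  obtain ⟨C, hC, h⟩ := neg_moment1 m
  refine ⟨C, hC, fun δ hδ hδ1 k => ?_⟩
  have hm0 : (0:ℝ) < m := by exact_mod_cast hm
  have hθ0 : 0 < (1 - δ) / (m:ℝ) := div_pos (by linarith) hm0
  induction k with
  | zero =>
    intro M α hα p₀ hp₀ a
    have : ∀ z : Fin 0 → ℝ, Fsum α z = α p₀ := by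
      intro z; simp [Fsum]; exact congrArg α (Subsingleton.elim _ _)
    simp [this]
  | succ k ih =>
    intro M α hα p₀ hp₀ a
    have hm1 : Measurable (fun z : Fin (k+1) → ℝ =>
        ‖Fsum α (fun i => z i + a i)‖ₑ ^ (-((1 - δ) / (m:ℝ)))) := by
      have : Continuous (fun z : Fin (k+1) → ℝ => Fsum α (fun i => z i + a i)) :=
        (Fsum_continuous α).comp (by fun_prop)
      have := this.measurable
      fun_prop
    have hm2 : ∀ β : (Fin k → Fin (m+1)) → ℝ, Measurable (fun z : Fin k → ℝ =>
        ‖Fsum β (fun i => z i + a i.succ)‖ₑ ^ (-((1 - δ) / (m:ℝ)))) := by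
      intro β
      have : Continuous (fun z : Fin k → ℝ => Fsum β (fun i => z i + a i.succ)) :=
        (Fsum_continuous β).comp (by fun_prop)
      have := this.measurable
      fun_prop
    obtain ⟨j, p', rfl⟩ : ∃ j p', p₀ = Fin.cons j p' := ⟨p₀ 0, Fin.tail p₀, (Fin.cons_self_tail p₀).symm⟩
    rw [sum_cons_nat] at hp₀
    rw [lint_succ _ _ hm1]
    simp only [cons_add, ← qpoly_eval]
    calc _ ≤ ∫⁻ z, ENNReal.ofReal (C / δ) * ‖Fsum (bcoef α (a 0) j) (fun i => z i + a i.succ)‖ₑ ^ (-((1 - δ) / (m:ℝ))) ∂(gam k) := by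
          refine lintegral_mono fun z => ?_
          rw [← qpoly_coeff]
          refine h _ (qpoly_natDegree _ _ _) _ δ hθ0 hδ hδ1.le ?_ j
          rw [mul_div_cancel₀ _ hm0.ne']
      _ = ENNReal.ofReal (C / δ) * ∫⁻ z, ‖Fsum (bcoef α (a 0) j) (fun i => z i + a i.succ)‖ₑ ^ (-((1 - δ) / (m:ℝ))) ∂(gam k) :=
          lintegral_const_mul _ (hm2 _)
      _ ≤ ENNReal.ofReal (C / δ) * (ENNReal.ofReal (C / δ) ^ k * ‖bcoef α (a 0) j p'‖ₑ ^ (-((1 - δ) / (m:ℝ)))) := by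
          gcongr
          refine ih (M - j) _ (fun p hp => ?_) p' (by omega) _
          have := bcoef_deg α (a 0) j hα p hp
          omega
      _ = _ := by
          rw [bcoef_top α (a 0) hα j p' hp₀, pow_succ']; ring

lemma osc_multi (m : ℕ) (hm : 1 ≤ m) : ∃ C : ℝ, 1 ≤ C ∧ ∀ (δ : ℝ), 0 < δ → δ < 1 →
    ∀ (k M : ℕ) (α : (Fin k → Fin (m + 1)) → ℝ), 1 ≤ M → (∀ p, α p ≠ 0 → ∑ i, (p i : ℕ) ≤ M) →
    ∀ p₀ : Fin k → Fin (m+1), ∑ i, (p₀ i : ℕ) = M → ∀ a : Fin k → ℝ,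
    ‖∫ z, Complex.exp (Complex.I * ((Fsum α (fun i => z i + a i) : ℝ) : ℂ)) ∂(gam k)‖ₑ ≤
      ENNReal.ofReal (C / δ) ^ k * ‖α p₀‖ₑ ^ (-((1 - δ) / m)) := by
  obtain ⟨C1, hC1, h1⟩ := neg_multi m hm
  obtain ⟨C2, hC2, h2⟩ := osc1 m hm
  refine ⟨max C1 C2, le_max_of_le_left hC1, fun δ hδ hδ1 k => ?_⟩
  have hCle1 : ENNReal.ofReal (C1 / δ) ≤ ENNReal.ofReal (max C1 C2 / δ) := by
    apply ENNReal.ofReal_le_ofReal; gcongr; exact le_max_left _ _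
  have hCle2 : ENNReal.ofReal (C2 / δ) ≤ ENNReal.ofReal (max C1 C2 / δ) := by
    apply ENNReal.ofReal_le_ofReal; gcongr; exact le_max_right _ _
  have hCone : 1 ≤ ENNReal.ofReal (max C1 C2 / δ) := by
    refine le_trans ?_ hCle1
    rw [← ENNReal.ofReal_one]; apply ENNReal.ofReal_le_ofReal
    rw [le_div_iff₀ hδ]; linarith
  induction k with
  | zero =>
    intro M α hM hα p₀ hp₀ a
    simp at hp₀; omega
  | succ k ih =>
    intro M α hM hα p₀ hp₀ a
    have hcont : Continuous (fun z : Fin (k+1) → ℝ =>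
        Complex.exp (Complex.I * ((Fsum α (fun i => z i + a i) : ℝ) : ℂ))) := by
      have : Continuous (fun z : Fin (k+1) → ℝ => Fsum α (fun i => z i + a i)) :=
        (Fsum_continuous α).comp (by fun_prop)
      fun_prop
    have hint := int_succ k _ hcont (fun z => by rw [mul_comm, Complex.norm_exp_ofReal_mul_I])
    have hm2 : ∀ β : (Fin k → Fin (m+1)) → ℝ, Measurable (fun z : Fin k → ℝ =>
        ‖Fsum β (fun i => z i + a i.succ)‖ₑ ^ (-((1 - δ) / (m:ℝ)))) := by
      intro β
      have : Continuous (fun z : Fin k → ℝ => Fsum β (fun i => z i + a i.succ)) :=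
        (Fsum_continuous β).comp (by fun_prop)
      have := this.measurable
      fun_prop
    obtain ⟨j, p', rfl⟩ : ∃ j p', p₀ = Fin.cons j p' := ⟨p₀ 0, Fin.tail p₀, (Fin.cons_self_tail p₀).symm⟩
    rw [sum_cons_nat] at hp₀
    rcases Nat.eq_zero_or_pos (j:ℕ) with hj | hj
    · rw [hint.2]
      have hj0 : j = 0 := Fin.ext hj
      have hF : ∀ (x : ℝ) (z : Fin k → ℝ),
          Fsum α (Fin.cons x z : Fin (k+1) → ℝ) = Fsum (bcoef α x 0) z := by
        intro x z
        rw [← qpoly_coeff, Polynomial.coeff_zero_eq_eval_zero, qpoly_eval, zero_add]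
      calc _ ≤ ∫⁻ x, ‖∫ z, Complex.exp (Complex.I * ((Fsum α (fun i => (Fin.cons x z : Fin (k+1) → ℝ) i + a i) : ℝ) : ℂ)) ∂(gam k)‖ₑ ∂(gaussianReal 0 1) :=
            enorm_integral_le_lintegral_enorm _
        _ ≤ ∫⁻ x, ENNReal.ofReal (max C1 C2 / δ) ^ k * ‖α (Fin.cons j p')‖ₑ ^ (-((1 - δ) / (m:ℝ))) ∂(gaussianReal 0 1) := by
            refine lintegral_mono fun x => ?_
            simp only [cons_add, hF]
            have e := bcoef_top α (x + a 0) hα j p' hp₀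
            rw [hj] at e
            rw [← e]
            refine ih M _ hM (fun p hp => ?_) p' (by omega) _
            have := bcoef_deg α (x + a 0) 0 hα p hp
            omega
        _ = ENNReal.ofReal (max C1 C2 / δ) ^ k * ‖α (Fin.cons j p')‖ₑ ^ (-((1 - δ) / (m:ℝ))) := by simp
        _ ≤ _ := by
            gcongr
            omega
    · rw [hint.1]
      simp only [cons_add, ← qpoly_eval]
      calc _ ≤ _ := enorm_integral_le_lintegral_enorm _
        _ ≤ ∫⁻ z, ENNReal.ofReal (C2 / δ) * ‖Fsum (bcoef α (a 0) j) (fun i => z i + a i.succ)‖ₑ ^ (-((1 - δ) / (m:ℝ))) ∂(gam k) := by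
            refine lintegral_mono fun z => ?_
            rw [← qpoly_coeff]
            exact h2 _ (qpoly_natDegree _ _ _) δ hδ hδ1 j hj
        _ = ENNReal.ofReal (C2 / δ) * ∫⁻ z, ‖Fsum (bcoef α (a 0) j) (fun i => z i + a i.succ)‖ₑ ^ (-((1 - δ) / (m:ℝ))) ∂(gam k) :=
            lintegral_const_mul _ (hm2 _)
        _ ≤ ENNReal.ofReal (C2 / δ) * (ENNReal.ofReal (C1 / δ) ^ k * ‖bcoef α (a 0) j p'‖ₑ ^ (-((1 - δ) / (m:ℝ)))) := by
            gcongr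
            refine h1 δ hδ hδ1 k (M - j) _ (fun p hp => ?_) p' (by omega) _
            have := bcoef_deg α (a 0) j hα p hp
            omega
        _ ≤ ENNReal.ofReal (max C1 C2 / δ) * (ENNReal.ofReal (max C1 C2 / δ) ^ k * ‖bcoef α (a 0) j p'‖ₑ ^ (-((1 - δ) / (m:ℝ)))) := by
            gcongr
        _ = _ := by
            rw [bcoef_top α (a 0) hα j p' hp₀, pow_succ']; ring

/-- (Theorem 3.) Let `Z` be a standard Gaussian random vector in `ℝᵏ` and let
`f(x) = Σ α(m₁,…,m_k) x₁^{m₁} ⋯ x_k^{m_k}` (all individual exponents `≤ m`) with zero constant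
term, total degree `M ≥ 2`, and `α_* > 0` the maximal absolute value of a coefficient of a
monomial of total degree `M`. Then there are constants `c₇, c₈ > 0` depending only on
`k, M, m` such that `sup_a |E exp(i t f(Z + a))| ≤ c₇ |α_* t|^{-1/m} ln^{c₈}(2 + |α_* t|)`. -/
theorem stmt_2 (k m M : ℕ) (hk : 1 ≤ k) (hM : 2 ≤ M) :
    ∃ c₇ c₈ : ℝ, 0 < c₇ ∧ 0 < c₈ ∧
      ∀ (α : (Fin k → Fin (m + 1)) → ℝ),
        α (fun _ => 0) = 0 →
        (∀ p, α p ≠ 0 → ∑ i, (p i : ℕ) ≤ M) →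
        (∃ p, α p ≠ 0 ∧ ∑ i, (p i : ℕ) = M) →
        ∀ (αstar : ℝ), 0 < αstar →
        (∀ p, ∑ i, (p i : ℕ) = M → |α p| ≤ αstar) →
        (∃ p, ∑ i, (p i : ℕ) = M ∧ |α p| = αstar) →
        ∀ (t : ℝ), t ≠ 0 →
        ∀ (a : Fin k → ℝ),
          ‖∫ z : Fin k → ℝ,
              Complex.exp (Complex.I * (t : ℂ) *
                ((∑ p : Fin k → Fin (m + 1), α p * ∏ i, (z i + a i) ^ (p i : ℕ) : ℝ) : ℂ))
              ∂(Measure.pi fun _ : Fin k => gaussianReal 0 1)‖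
            ≤ c₇ * |αstar * t| ^ (-(1 : ℝ) / m) *
                Real.log (2 + |αstar * t|) ^ c₈ := by
  rcases Nat.eq_zero_or_pos m with rfl | hm
  · refine ⟨1, 1, one_pos, one_pos, ?_⟩
    intro α _ _ h3
    obtain ⟨p, _, hp⟩ := h3
    simp at hp
    omega
  obtain ⟨C, hC, h⟩ := osc_multi m hm
  have hm0 : (0:ℝ) < m := by exact_mod_cast hm
  have hm1 : (1:ℝ) ≤ m := by exact_mod_cast hm
  refine ⟨(2 * C) ^ k * Real.exp 1, k, by positivity, by exact_mod_cast hk, ?_⟩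
  intro α _ hα _ αstar hαs _ hex t ht a
  obtain ⟨p₀, hp₀, hαp⟩ := hex
  set b := |αstar * t| with hb
  have hb0 : 0 < b := abs_pos.2 (mul_ne_zero hαs.ne' ht)
  set L := Real.log (2 + b) with hL
  have hL2 : 1 / 2 < L := by
    have h1 : Real.log 2 ≤ L := Real.log_le_log (by norm_num) (by linarith)
    have := Real.log_two_gt_d9
    linarith
  have hL0 : 0 < L := by linarith
  set δ := 1 / (2 * L) with hδ
  have hδ0 : 0 < δ := by positivity
  have hδ1 : δ < 1 := by
    rw [hδ, div_lt_one (by positivity)]; linarith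
  have key := h δ hδ0 hδ1 k M (fun p => t * α p) (by omega)
    (fun p hp => hα p (right_ne_zero_of_mul hp)) p₀ hp₀ a
  have hF : ∀ z : Fin k → ℝ, Complex.I * (t : ℂ) *
      ((∑ p : Fin k → Fin (m + 1), α p * ∏ i, (z i + a i) ^ (p i : ℕ) : ℝ) : ℂ) =
      Complex.I * ((Fsum (fun p => t * α p) (fun i => z i + a i) : ℝ) : ℂ) := by
    intro z
    rw [mul_assoc, ← Complex.ofReal_mul]
    congr 2
    rw [Fsum, Finset.mul_sum]
    refine Finset.sum_congr rfl fun p _ => ?_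
    ring
  simp only [hF]
  have hbp : |t * α p₀| = b := by
    rw [hb, abs_mul, abs_mul, hαp, abs_of_pos hαs, mul_comm]
  have hne : t * α p₀ ≠ 0 := by
    intro h0; rw [h0] at hbp; simp at hbp; linarith
  rw [aux_rpow_enorm _ _ hne, hbp, ← ENNReal.ofReal_pow (by positivity),
    ← ENNReal.ofReal_mul (by positivity), ← ofReal_norm] at key
  have key2 := (ENNReal.ofReal_le_ofReal_iff (by positivity)).1 key
  refine key2.trans ?_
  have e1 : C / δ = 2 * C * L := by rw [hδ]; field_simp
  have e2 : b ^ (-((1 - δ) / (m:ℝ))) ≤ b ^ (-(1:ℝ) / m) * Real.exp 1 := by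
    have : -((1 - δ) / (m:ℝ)) = -(1:ℝ) / m + δ / m := by field_simp; ring
    rw [this, Real.rpow_add hb0]
    gcongr
    rw [Real.rpow_def_of_pos hb0]
    apply Real.exp_le_exp.2
    have hlog : Real.log b ≤ L := Real.log_le_log hb0 (by linarith)
    calc Real.log b * (δ / m) ≤ L * (δ / m) := by gcongr
      _ ≤ L * (δ / 1) := by gcongr
      _ = 1 / 2 := by rw [hδ]; field_simp
      _ ≤ 1 := by norm_num
  rw [e1, mul_pow, Real.rpow_natCast]
  calc (2 * C) ^ k * L ^ k * b ^ (-((1 - δ) / (m:ℝ)))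
      ≤ (2 * C) ^ k * L ^ k * (b ^ (-(1:ℝ) / m) * Real.exp 1) := by gcongr
    _ = _ := by ring
end

section
/- Let X be a real random variable with |X| ≤ 1, characteristic function g_X(t) = E exp{itX}, and set φ_X(T) = ∫_{-T}^{T} |g_X(t)| dt for T > 0. Let m ≥ 2 and f(x) = x^m + α_{m-1}x^{m-1} + ... + α_0 be a monic polynomial of degree m. Assume that there exists a nondecreasing positive function φ(t) on (0,∞) and a constant ε with 0 ≤ ε < 1/m such that φ_X(bt) ≤ b^ε φ(t) for all t ≥ 1 and all b ≥ 1. Then there exists a constant c, not depending on t, such that for all |t| ≥ 1, |E exp{i t f(X)}| ≤ c φ(|t|) |t|^{-1/m}. -/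
open MeasureTheory ProbabilityTheory Filter Set
open Polynomial in
noncomputable def eP (p : ℝ[X]) (x : ℝ) : ℂ := Complex.exp (Complex.I * ((p.eval x : ℝ) : ℂ))

lemma eP_norm (p : Polynomial ℝ) (x : ℝ) : ‖eP p x‖ = 1 := by
  unfold eP; rw [mul_comm]; exact Complex.norm_exp_ofReal_mul_I _

lemma eP_deriv (p : Polynomial ℝ) (x : ℝ) :
    HasDerivAt (eP p) (Complex.I * ((p.derivative.eval x : ℝ) : ℂ) * eP p x) x := by
  have h := ((p.hasDerivAt x).ofReal_comp.const_mul Complex.I).cexp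
  unfold eP
  convert h using 1
  ring

lemma eP_cont (p : Polynomial ℝ) : Continuous (eP p) :=
  continuous_iff_continuousAt.2 fun x => (eP_deriv p x).continuousAt

lemma eP_neg (p : Polynomial ℝ) (x : ℝ) : eP (-p) x = (starRingEnd ℂ) (eP p x) := by
  unfold eP
  rw [← Complex.exp_conj]
  simp

lemma eP_neg_int (p : Polynomial ℝ) (a b : ℝ) : ‖∫ x in a..b, eP (-p) x‖ = ‖∫ x in a..b, eP p x‖ := by
  have : ∫ x in a..b, eP (-p) x = (starRingEnd ℂ) (∫ x in a..b, eP p x) := by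
    simp only [eP_neg, intervalIntegral.intervalIntegral_eq_integral_uIoc, integral_conj]
    split_ifs <;> simp
  rw [this, RCLike.norm_conj]

lemma vdc_base (p : Polynomial ℝ) (a b l : ℝ) (hab : a ≤ b) (hl : 0 < l)
    (h1 : ∀ x ∈ Icc a b, l ≤ |p.derivative.eval x|)
    (h2 : ∀ x ∈ Icc a b, 0 ≤ p.derivative.derivative.eval x) :
    ‖∫ x in a..b, eP p x‖ ≤ 4 / l := by
  set q := p.derivative with hq
  have hne : ∀ x ∈ Icc a b, q.eval x ≠ 0 := fun x hx h0 => by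
    have := h1 x hx; rw [h0, abs_zero] at this; linarith
  have huI : uIcc a b = Icc a b := uIcc_of_le hab
  have hr : ContinuousOn (fun x => q.derivative.eval x / (q.eval x)^2) (Icc a b) :=
    (q.derivative.continuous.continuousOn).div (q.continuous.pow 2).continuousOn
      fun x hx => pow_ne_zero _ (hne x hx)
  have hri : IntervalIntegrable (fun x => q.derivative.eval x / (q.eval x)^2) volume a b :=
    ContinuousOn.intervalIntegrable (by rwa [huI])
  have hI2 : ∫ x in a..b, q.derivative.eval x / (q.eval x)^2 = (q.eval a)⁻¹ - (q.eval b)⁻¹ := by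
    have := intervalIntegral.integral_eq_sub_of_hasDerivAt (f := fun x => - (q.eval x)⁻¹)
      (f' := fun x => q.derivative.eval x / (q.eval x)^2) (a := a) (b := b) (by
        intro x hx
        rw [huI] at hx
        refine HasDerivAt.congr_deriv ((q.hasDerivAt x).inv (hne x hx)).neg ?_
        ring) hri
    rw [this]; ring
  have hc2 : ContinuousOn (fun x => Complex.I * ((q.derivative.eval x / (q.eval x)^2 : ℝ) : ℂ) * eP p x) (Icc a b) :=
    (continuousOn_const.mul (Complex.continuous_ofReal.comp_continuousOn hr)).mul (eP_cont p).continuousOn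
  have hi2 : IntervalIntegrable (fun x => Complex.I * ((q.derivative.eval x / (q.eval x)^2 : ℝ) : ℂ) * eP p x) volume a b :=
    ContinuousOn.intervalIntegrable (by rwa [huI])
  have hi1 : IntervalIntegrable (eP p) volume a b := (eP_cont p).intervalIntegrable _ _
  have hF := intervalIntegral.integral_eq_sub_of_hasDerivAt
      (f := fun x => -Complex.I * (((q.eval x)⁻¹ : ℝ) : ℂ) * eP p x)
      (f' := fun x => eP p x + Complex.I * ((q.derivative.eval x / (q.eval x)^2 : ℝ) : ℂ) * eP p x) (a := a) (b := b) (by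
        intro x hx
        rw [huI] at hx
        have hd := (((q.hasDerivAt x).inv (hne x hx)).ofReal_comp.const_mul (-Complex.I)).mul (eP_deriv p x)
        refine HasDerivAt.congr_deriv hd ?_
        have := hne x hx
        have h' : ((q.eval x : ℝ) : ℂ) ≠ 0 := by exact_mod_cast this
        simp only [← hq, Pi.inv_apply]
        push_cast
        field_simp
        linear_combination (-eP p x * ((q.eval x : ℝ) : ℂ)^2) * Complex.I_sq) (hi1.add hi2)
  rw [intervalIntegral.integral_add hi1 hi2] at hF
  have hinv : ∀ x ∈ Icc a b, |(q.eval x)⁻¹| ≤ l⁻¹ := fun x hx => by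
    rw [abs_inv]; exact inv_anti₀ hl (h1 x hx)
  have ha := hinv a (left_mem_Icc.2 hab)
  have hb := hinv b (right_mem_Icc.2 hab)
  have hn2 : ‖∫ x in a..b, Complex.I * ((q.derivative.eval x / (q.eval x)^2 : ℝ) : ℂ) * eP p x‖ ≤ 2 * l⁻¹ := by
    calc _ ≤ ∫ x in a..b, q.derivative.eval x / (q.eval x)^2 := by
          apply intervalIntegral.norm_integral_le_of_norm_le hab _ hri
          refine Eventually.of_forall fun x hx => ?_
          have hx' := h2 x (Ioc_subset_Icc_self hx)
          rw [norm_mul, norm_mul, eP_norm, Complex.norm_I, Complex.norm_real, Real.norm_eq_abs,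
            abs_of_nonneg (by positivity)]
          simp
      _ ≤ 2 * l⁻¹ := by
          rw [hI2]
          have := abs_le.1 ha; have := abs_le.1 hb; linarith
  have hnF : ∀ x, ‖-Complex.I * (((q.eval x)⁻¹ : ℝ) : ℂ) * eP p x‖ = |(q.eval x)⁻¹| := fun x => by
    rw [norm_mul, norm_mul, eP_norm, norm_neg, Complex.norm_I, Complex.norm_real, Real.norm_eq_abs]; simp
  have e : ∫ x in a..b, eP p x = (-Complex.I * (((q.eval b)⁻¹ : ℝ) : ℂ) * eP p b - -Complex.I * (((q.eval a)⁻¹ : ℝ) : ℂ) * eP p a) -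
    ∫ x in a..b, Complex.I * ((q.derivative.eval x / (q.eval x)^2 : ℝ) : ℂ) * eP p x := by
    rw [← hF]; ring
  rw [e]
  have h4 := norm_sub_le (-Complex.I * (((q.eval b)⁻¹ : ℝ) : ℂ) * eP p b - -Complex.I * (((q.eval a)⁻¹ : ℝ) : ℂ) * eP p a)
    (∫ x in a..b, Complex.I * ((q.derivative.eval x / (q.eval x)^2 : ℝ) : ℂ) * eP p x)
  have h5 := norm_sub_le (-Complex.I * (((q.eval b)⁻¹ : ℝ) : ℂ) * eP p b) (-Complex.I * (((q.eval a)⁻¹ : ℝ) : ℂ) * eP p a)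
  rw [hnF, hnF] at h5
  rw [div_eq_mul_inv]
  linarith

lemma vdc_step (p : Polynomial ℝ) (q : Polynomial ℝ) (a b l d K : ℝ) (hab : a ≤ b) (hl : 0 < l) (hd : 0 < d)
    (hK : 0 ≤ K)
    (h1 : ∀ x ∈ Icc a b, l ≤ q.derivative.eval x)
    (h2 : ∀ c e, a ≤ c → c ≤ e → e ≤ b →
      ((∀ x ∈ Icc c e, l * d ≤ q.eval x) ∨ (∀ x ∈ Icc c e, q.eval x ≤ -(l * d))) →
      ‖∫ x in c..e, eP p x‖ ≤ K) :
    ‖∫ x in a..b, eP p x‖ ≤ 2 * K + 2 * d := by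
  have hm : ∀ x ∈ Icc a b, ∀ y ∈ Icc a b, x ≤ y → l * (y - x) ≤ q.eval y - q.eval x := by
    apply Convex.mul_sub_le_image_sub_of_le_deriv (convex_Icc a b) q.continuous.continuousOn
      q.differentiable.differentiableOn
    intro x hx
    rw [q.deriv]
    exact h1 x (interior_subset hx)
  obtain ⟨z, hz, hz1, hz2⟩ : ∃ z ∈ Icc a b, (∀ x ∈ Icc a b, z < x → l * (x - z) ≤ q.eval x) ∧
      (∀ x ∈ Icc a b, x < z → q.eval x ≤ -(l * (z - x))) := by
    have haI := left_mem_Icc.2 hab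
    have hbI := right_mem_Icc.2 hab
    rcases le_total 0 (q.eval a) with h | h
    · refine ⟨a, haI, fun x hx hx' => ?_, fun x hx hx' => ?_⟩
      · have := hm a haI x hx hx'.le; linarith
      · exact absurd hx.1 (not_le.2 hx')
    rcases le_total (q.eval b) 0 with h' | h'
    · refine ⟨b, hbI, fun x hx hx' => ?_, fun x hx hx' => ?_⟩
      · exact absurd hx.2 (not_le.2 hx')
      · have := hm x hx b hbI hx'.le; linarith
    · obtain ⟨z, hz, hz0⟩ := intermediate_value_Icc hab q.continuous.continuousOn ⟨h, h'⟩
      have hz0 : q.eval z = 0 := hz0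
      refine ⟨z, hz, fun x hx hx' => ?_, fun x hx hx' => ?_⟩
      · have := hm z hz x hx hx'.le; linarith
      · have := hm x hx z hz hx'.le; linarith
  have hii : ∀ c e, IntervalIntegrable (eP p) volume c e := fun c e => (eP_cont p).intervalIntegrable _ _
  obtain ⟨hza, hzb⟩ := hz
  have hA : ‖∫ x in a..(max a (z - d)), eP p x‖ ≤ K := by
    rcases le_total a (z - d) with h | h
    · rw [max_eq_right h]
      refine h2 a (z - d) le_rfl h (by linarith) (Or.inr fun x hx => ?_)
      have := hz2 x ⟨hx.1, by linarith [hx.2]⟩ (by linarith [hx.2])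
      nlinarith [hx.2]
    · rw [max_eq_left h]; simpa using hK
  have hB : ‖∫ x in (min b (z + d))..b, eP p x‖ ≤ K := by
    rcases le_total b (z + d) with h | h
    · rw [min_eq_left h]; simpa using hK
    · rw [min_eq_right h]
      refine h2 (z + d) b (by linarith) h le_rfl (Or.inl fun x hx => ?_)
      have := hz1 x ⟨by linarith [hx.1], hx.2⟩ (by linarith [hx.1])
      nlinarith [hx.1]
  have hC : ‖∫ x in (max a (z - d))..(min b (z + d)), eP p x‖ ≤ 2 * d := by
    have := intervalIntegral.norm_integral_le_of_norm_le_const (C := 1) (f := eP p)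
      (a := max a (z - d)) (b := min b (z + d)) (fun x _ => (eP_norm p x).le)
    refine this.trans ?_
    have h1 : max a (z - d) ≤ z := max_le hza (by linarith)
    have h2 : z ≤ min b (z + d) := le_min hzb (by linarith)
    rw [abs_of_nonneg (by linarith)]
    linarith [le_max_right a (z - d), min_le_right b (z + d)]
  rw [← intervalIntegral.integral_add_adjacent_intervals (hii a (max a (z - d))) (hii _ b),
    ← intervalIntegral.integral_add_adjacent_intervals (hii (max a (z - d)) (min b (z + d))) (hii _ b)]
  refine (norm_add_le _ _).trans ?_
  have := norm_add_le (∫ x in (max a (z - d))..(min b (z + d)), eP p x) (∫ x in (min b (z + d))..b, eP p x)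
  linarith

lemma vdc (k : ℕ) (hk : 2 ≤ k) : ∃ C : ℝ, 0 ≤ C ∧ ∀ (p : Polynomial ℝ) (a b l : ℝ), a ≤ b → 0 < l →
    (∀ x ∈ Icc a b, l ≤ (Polynomial.derivative^[k] p).eval x) →
    ‖∫ x in a..b, eP p x‖ ≤ C * l ^ (-(1 : ℝ) / k) := by
  have key : ∀ (k : ℕ) (l : ℝ), 1 ≤ k → 0 < l → (l * l ^ (-(1 : ℝ) / (k + 1 : ℕ))) ^ (-(1 : ℝ) / k)
      = l ^ (-(1 : ℝ) / (k + 1 : ℕ)) := by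
    intro k l hk hl
    have : (k : ℝ) ≠ 0 := by positivity
    have : ((k + 1 : ℕ) : ℝ) ≠ 0 := by positivity
    nth_rewrite 1 [← Real.rpow_one l]
    rw [← Real.rpow_add hl, ← Real.rpow_mul hl.le]
    congr 1
    push_cast at *
    field_simp
    ring
  induction k, hk using Nat.le_induction with
  | base =>
    refine ⟨10, by norm_num, fun p a b l hab hl h => ?_⟩
    set d := l ^ (-(1 : ℝ) / (2 : ℕ)) with hd
    have hd0 : 0 < d := Real.rpow_pos_of_pos hl _
    have := vdc_step p (Polynomial.derivative p) a b l d (4 / (l * d)) hab hl hd0 (by positivity) h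
      (fun c e hc hce he hh => vdc_base p c e (l * d) hce (by positivity)
        (fun x hx => by
          rcases hh with hh | hh
          · exact (hh x hx).trans (le_abs_self _)
          · exact (le_neg_of_le_neg (hh x hx)).trans (neg_le_abs _))
        (fun x hx => hl.le.trans (h x ⟨hc.trans hx.1, hx.2.trans he⟩)))
    have h2 := key 1 l le_rfl hl
    have h3 : (l * d)⁻¹ = d := by
      rw [← Real.rpow_neg_one]
      simpa [hd] using h2
    rw [div_eq_mul_inv, h3] at this
    linarith
  | succ k hk ih =>
    obtain ⟨C, hC, ih⟩ := ih
    refine ⟨2 * C + 2, by positivity, fun p a b l hab hl h => ?_⟩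
    set d := l ^ (-(1 : ℝ) / (k + 1 : ℕ)) with hd
    have hd0 : 0 < d := Real.rpow_pos_of_pos hl _
    have := vdc_step p (Polynomial.derivative^[k] p) a b l d (C * d) hab hl hd0 (by positivity)
      (by rw [Function.iterate_succ_apply'] at h; exact h)
      (fun c e hc hce he hh => by
        have hld : 0 < l * d := by positivity
        have hk2 := key k l (by omega) hl
        rw [← hd] at hk2
        rw [← hk2]
        rcases hh with hh | hh
        · exact ih p c e (l * d) hce hld hh
        · rw [← eP_neg_int]
          refine ih (-p) c e (l * d) hce hld fun x hx => ?_
          rw [Polynomial.iterate_derivative_neg, Polynomial.eval_neg]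
          linarith [hh x hx])
    linarith

lemma vdc_abs (k : ℕ) (hk : 2 ≤ k) : ∃ C : ℝ, 0 ≤ C ∧ ∀ (p : Polynomial ℝ) (a b v : ℝ), a ≤ b → v ≠ 0 →
    (∀ x ∈ Icc a b, (Polynomial.derivative^[k] p).eval x = v) →
    ‖∫ x in a..b, eP p x‖ ≤ C * |v| ^ (-(1 : ℝ) / k) := by
  obtain ⟨C, hC, h⟩ := vdc k hk
  refine ⟨C, hC, fun p a b v hab hv hp => ?_⟩
  rcases lt_or_gt_of_ne hv with h0 | h0
  · rw [← eP_neg_int]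
    refine h (-p) a b _ hab (by positivity) fun x hx => ?_
    rw [Polynomial.iterate_derivative_neg, Polynomial.eval_neg, hp x hx, abs_of_neg h0]
  · refine h p a b _ hab (by positivity) fun x hx => ?_
    rw [hp x hx, abs_of_pos h0]

lemma amp (p : Polynomial ℝ) (χ χ' : ℝ → ℝ) (hχ : ∀ x, HasDerivAt χ (χ' x) x) (hc : Continuous χ')
    (h2 : χ 2 = 0) (D B : ℝ) (hD : ∀ x ∈ Icc (-2 : ℝ) 2, |χ' x| ≤ D)
    (hB : ∀ x ∈ Icc (-2 : ℝ) 2, ‖∫ y in (-2)..x, eP p y‖ ≤ B) :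
    ‖∫ x in (-2 : ℝ)..2, (χ x : ℂ) * eP p x‖ ≤ D * B * 4 := by
  have := intervalIntegral.integral_mul_deriv_eq_deriv_mul (a := -2) (b := 2)
    (u := fun x => (χ x : ℂ)) (u' := fun x => (χ' x : ℂ)) (v := fun x => ∫ y in (-2)..x, eP p y)
    (v' := eP p) (fun x _ => (hχ x).ofReal_comp)
    (fun x _ => intervalIntegral.integral_hasDerivAt_right ((eP_cont p).intervalIntegrable _ _)
      ((eP_cont p).stronglyMeasurableAtFilter _ _) (eP_cont p).continuousAt)
    ((Complex.continuous_ofReal.comp hc).intervalIntegrable _ _) ((eP_cont p).intervalIntegrable _ _)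
  rw [this]
  simp only [h2, intervalIntegral.integral_same, Complex.ofReal_zero, zero_mul, mul_zero, sub_zero, zero_sub, norm_neg]
  have h := intervalIntegral.norm_integral_le_of_norm_le_const (C := D * B)
    (f := fun x => (χ' x : ℂ) * ∫ y in (-2)..x, eP p y) (a := -2) (b := 2) (fun x hx => by
      rw [uIoc_of_le (by norm_num)] at hx
      have hx' := Ioc_subset_Icc_self hx
      rw [norm_mul, Complex.norm_real, Real.norm_eq_abs]
      exact mul_le_mul (hD x hx') (hB x hx') (norm_nonneg _) ((abs_nonneg _).trans (hD x hx')))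
  refine h.trans (le_of_eq ?_)
  norm_num

lemma tail (F : Polynomial ℝ) (χ χ' χ'' : ℝ → ℝ) (hχ : ∀ x, HasDerivAt χ (χ' x) x)
    (hχ' : ∀ x, HasDerivAt χ' (χ'' x) x) (hc : Continuous χ'')
    (h2 : χ 2 = 0) (h3 : χ (-2) = 0) (h2' : χ' 2 = 0) (h3' : χ' (-2) = 0) :
    ∃ A C : ℝ, 1 ≤ A ∧ 0 ≤ C ∧ ∀ t s : ℝ, s ≠ 0 → A * |t| ≤ |s| →
      ‖∫ x in (-2 : ℝ)..2, (χ x : ℂ) * eP (Polynomial.C t * F - Polynomial.C s * Polynomial.X) x‖ ≤ C / s ^ 2 := by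
  have hcχ : Continuous χ := continuous_iff_continuousAt.2 fun x => (hχ x).continuousAt
  have hcχ' : Continuous χ' := continuous_iff_continuousAt.2 fun x => (hχ' x).continuousAt
  set F1 := F.derivative with hF1
  set F2 := F1.derivative with hF2
  set F3 := F2.derivative with hF3
  obtain ⟨M, hM⟩ := (isCompact_Icc (a := (-2 : ℝ)) (b := 2)).exists_bound_of_continuousOn F1.continuous.continuousOn
  set A := max 1 (2 * M) with hA
  have hA1 : 1 ≤ A := le_max_left _ _
  have hA2 : 2 * M ≤ A := le_max_right _ _
  have hu : ∀ τ : ℝ, A * |τ| ≤ 1 → ∀ x ∈ Icc (-2 : ℝ) 2, 1 - τ * F1.eval x ≠ 0 := by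
    intro τ hτ x hx h0
    have h1 := hM x hx
    rw [Real.norm_eq_abs] at h1
    have h4 : |τ * F1.eval x| = 1 := by
      rw [show τ * F1.eval x = 1 by linarith]; simp
    rw [abs_mul] at h4
    nlinarith [abs_nonneg τ, mul_le_mul_of_nonneg_left h1 (abs_nonneg τ), mul_le_mul_of_nonneg_right hA2 (abs_nonneg τ)]
  let G : ℝ × ℝ → ℝ := fun z => ((χ'' z.2 * (1 - z.1 * F1.eval z.2) - χ z.2 * (- (z.1 * F3.eval z.2))) * (1 - z.1 * F1.eval z.2) ^ 3
    - (χ' z.2 * (1 - z.1 * F1.eval z.2) - χ z.2 * (- (z.1 * F2.eval z.2))) * (3 * (1 - z.1 * F1.eval z.2) ^ 2 * (- (z.1 * F2.eval z.2))))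
     / ((1 - z.1 * F1.eval z.2) ^ 3) ^ 2
  have hS : IsCompact ((Icc (-A⁻¹) A⁻¹) ×ˢ (Icc (-2 : ℝ) 2)) := isCompact_Icc.prod isCompact_Icc
  have hA0 : 0 < A := by linarith
  have hG : ContinuousOn G ((Icc (-A⁻¹) A⁻¹) ×ˢ (Icc (-2 : ℝ) 2)) := by
    have c1 := F1.continuous
    have c2 := F2.continuous
    have c3 := F3.continuous
    apply ContinuousOn.div
    · apply Continuous.continuousOn; fun_prop
    · apply Continuous.continuousOn; fun_prop
    · rintro ⟨τ, x⟩ ⟨hτ, hx⟩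
      refine pow_ne_zero _ (pow_ne_zero _ (hu τ ?_ x hx))
      have : |τ| ≤ A⁻¹ := abs_le.2 hτ
      calc A * |τ| ≤ A * A⁻¹ := by gcongr
        _ = 1 := mul_inv_cancel₀ hA0.ne'
  obtain ⟨C, hC⟩ := hS.exists_bound_of_continuousOn hG
  have hC0 : 0 ≤ C := (norm_nonneg _).trans (hC (0, 0) ⟨by simp [hA0.le], by simp⟩)
  refine ⟨A, C * 4, hA1, by positivity, fun t s hs hts => ?_⟩
  set p := Polynomial.C t * F - Polynomial.C s * Polynomial.X with hp
  set τ := t / s with hτ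
  have hs' : 0 < |s| := abs_pos.2 hs
  have hτ1 : A * |τ| ≤ 1 := by
    rw [hτ, abs_div, ← mul_div_assoc, div_le_one hs']; exact hts
  have hτ2 : τ ∈ Icc (-A⁻¹) A⁻¹ := by
    rw [mem_Icc, ← abs_le, ← one_div, le_div_iff₀ hA0]; linarith
  have hpd : ∀ x, p.derivative.eval x = -s * (1 - τ * F1.eval x) := by
    intro x
    simp [hp, hτ, ← hF1]
    field_simp
    ring
  have hu1 : ∀ x, HasDerivAt (fun x => 1 - τ * F1.eval x) (-(τ * F2.eval x)) x := fun x => by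
    simpa using ((F1.hasDerivAt x).const_mul τ).const_sub 1
  have hu2 : ∀ x, HasDerivAt (fun x => -(τ * F2.eval x)) (-(τ * F3.eval x)) x := fun x => by
    exact ((F2.hasDerivAt x).const_mul τ).neg
  let b : ℝ → ℝ := fun x => χ x / (1 - τ * F1.eval x)
  let b1 : ℝ → ℝ := fun x => (χ' x * (1 - τ * F1.eval x) - χ x * (-(τ * F2.eval x))) / (1 - τ * F1.eval x) ^ 2
  let b2 : ℝ → ℝ := fun x => (χ' x * (1 - τ * F1.eval x) - χ x * (-(τ * F2.eval x))) / (1 - τ * F1.eval x) ^ 3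
  have hb : ∀ x ∈ Icc (-2 : ℝ) 2, HasDerivAt b (b1 x) x := fun x hx =>
    (hχ x).div (hu1 x) (hu τ hτ1 x hx)
  have hb2 : ∀ x ∈ Icc (-2 : ℝ) 2, HasDerivAt b2 (G (τ, x)) x := fun x hx => by
    have := (((hχ' x).mul (hu1 x)).sub ((hχ x).mul (hu2 x))).div ((hu1 x).pow 3) (pow_ne_zero 3 (hu τ hτ1 x hx))
    refine HasDerivAt.congr_deriv this ?_
    simp only [G]
    simp
    ring
  have hint1 : IntervalIntegrable (fun x => (χ x : ℂ) * eP p x) volume (-2) 2 :=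
    ((Complex.continuous_ofReal.comp hcχ).mul (eP_cont p)).intervalIntegrable _ _
  have hint2 : IntervalIntegrable (fun x => (G (τ, x) : ℂ) * eP p x) volume (-2) 2 := by
    apply ContinuousOn.intervalIntegrable
    rw [uIcc_of_le (by norm_num)]
    refine (Complex.continuous_ofReal.comp_continuousOn ?_).mul (eP_cont p).continuousOn
    exact hG.comp (by fun_prop) (fun x hx => ⟨hτ2, hx⟩)
  have hFTC := intervalIntegral.integral_eq_sub_of_hasDerivAt (a := -2) (b := 2)
    (f := fun x => (Complex.I * s * (b x : ℂ) + (b2 x : ℂ)) * eP p x)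
    (f' := fun x => (s : ℂ) ^ 2 * ((χ x : ℂ) * eP p x) + (G (τ, x) : ℂ) * eP p x) (by
      intro x hx
      rw [uIcc_of_le (by norm_num)] at hx
      have hd := ((((hb x hx).ofReal_comp).const_mul (Complex.I * s)).add ((hb2 x hx).ofReal_comp)).mul (eP_deriv p x)
      refine HasDerivAt.congr_deriv hd ?_
      have hux := hu τ hτ1 x hx
      have e1 : b x * (1 - τ * F1.eval x) = χ x := by simp only [b]; field_simp
      have e2 : b2 x * (1 - τ * F1.eval x) = b1 x := by simp only [b1, b2]; field_simp
      rw [hpd]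
      have e1' : (b x : ℂ) * ((1 - τ * F1.eval x : ℝ) : ℂ) = χ x := by exact_mod_cast e1
      have e2' : (b2 x : ℂ) * ((1 - τ * F1.eval x : ℝ) : ℂ) = b1 x := by exact_mod_cast e2
      rw [Complex.ofReal_mul, ← e1', ← e2']
      simp only [Pi.add_apply]
      generalize ((1 - τ * F1.eval x : ℝ) : ℂ) = u
      push_cast
      linear_combination (-(s : ℂ) ^ 2 * b x * u * eP p x) * Complex.I_sq) ((hint1.const_mul _).add hint2)
  rw [intervalIntegral.integral_add (hint1.const_mul _) hint2, intervalIntegral.integral_const_mul] at hFTC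
  simp only [b, b2, h2, h3, h2', h3'] at hFTC
  simp at hFTC
  have hfin : (s : ℂ) ^ 2 * ∫ x in (-2 : ℝ)..2, (χ x : ℂ) * eP p x = -∫ x in (-2 : ℝ)..2, (G (τ, x) : ℂ) * eP p x :=
    eq_neg_of_add_eq_zero_left hFTC
  have hn := congrArg norm hfin
  rw [norm_mul, norm_neg, norm_pow, Complex.norm_real, Real.norm_eq_abs, sq_abs] at hn
  rw [le_div_iff₀ (by positivity), mul_comm, hn]
  have h := intervalIntegral.norm_integral_le_of_norm_le_const (C := C)
    (f := fun x => (G (τ, x) : ℂ) * eP p x) (a := -2) (b := 2) (fun x hx => by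
      rw [uIoc_of_le (by norm_num)] at hx
      have hx' := Ioc_subset_Icc_self hx
      rw [norm_mul, Complex.norm_real, eP_norm, mul_one]
      exact hC (τ, x) ⟨hτ2, hx'⟩)
  refine h.trans (le_of_eq ?_)
  norm_num
open scoped FourierTransform SchwartzMap in
lemma inv_bound {Ω : Type*} [MeasurableSpace Ω] (P : Measure Ω) [IsProbabilityMeasure P]
    (X : Ω → ℝ) (hXm : Measurable X) (h : 𝓢(ℝ, ℂ)) :
    ‖∫ ω, h (X ω) ∂P‖ ≤ ∫ ξ : ℝ, ‖(𝓕 (h : ℝ → ℂ)) ξ‖ *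
      ‖∫ ω, Complex.exp (Complex.I * ((2 * Real.pi * ξ : ℝ) : ℂ) * (X ω : ℂ)) ∂P‖ := by
  have hint : Integrable (𝓕 (h : ℝ → ℂ)) := by
    rw [← SchwartzMap.fourier_coe]; exact (𝓕 h).integrable
  have hcont : Continuous (𝓕 (h : ℝ → ℂ)) := by
    rw [← SchwartzMap.fourier_coe]; exact (𝓕 h).continuous
  have e1 : ∀ x : ℝ, h x = ∫ ξ : ℝ, Complex.exp (Complex.I * ((2 * Real.pi * ξ : ℝ) : ℂ) * (x : ℂ)) * 𝓕 (h : ℝ → ℂ) ξ := by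
    intro x
    have := congrFun (h.continuous.fourierInv_fourier_eq h.integrable hint) x
    rw [← this, Real.fourierInv_eq']
    refine integral_congr_ae (Eventually.of_forall fun ξ => ?_)
    simp only [smul_eq_mul]
    congr 2
    simp
    ring
  have hprod : Integrable (Function.uncurry fun (ω : Ω) (ξ : ℝ) =>
      Complex.exp (Complex.I * ((2 * Real.pi * ξ : ℝ) : ℂ) * (X ω : ℂ)) * 𝓕 (h : ℝ → ℂ) ξ) (P.prod volume) := by
    have hs : Integrable (fun z : Ω × ℝ => 𝓕 (h : ℝ → ℂ) z.2) (P.prod volume) := hint.comp_snd P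
    refine hs.mono ?_ ?_
    · apply Measurable.aestronglyMeasurable
      have := hcont.measurable
      unfold Function.uncurry
      fun_prop
    · refine Eventually.of_forall fun z => ?_
      simp only [Function.uncurry, norm_mul]
      rw [show Complex.I * ((2 * Real.pi * z.2 : ℝ) : ℂ) * (X z.1 : ℂ) = ((2 * Real.pi * z.2 * X z.1 : ℝ) : ℂ) * Complex.I by push_cast; ring,
        Complex.norm_exp_ofReal_mul_I, one_mul]
  simp_rw [e1]
  rw [integral_integral_swap hprod]
  refine (norm_integral_le_integral_norm _).trans (le_of_eq ?_)
  refine integral_congr_ae (Eventually.of_forall fun ξ => ?_)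
  simp only
  rw [integral_mul_const, norm_mul, mul_comm]

lemma split_bound (u G : ℝ → ℝ) (hG : Continuous G) (hG0 : ∀ x, 0 ≤ G x) (hG1 : ∀ x, G x ≤ 1)
    (hu0 : ∀ x, 0 ≤ u x) (R B C : ℝ) (hR : 0 < R)
    (hB : ∀ x, u x ≤ B) (hC : ∀ x, R ≤ |x| → u x ≤ C / x ^ 2) (hC0 : 0 ≤ C) :
    ∫ x, u x * G x ≤ B * (∫ x in (-R)..R, G x) + C * (2 / R) := by
  let k : ℝ → ℝ := (Ioi R).indicator fun x => x ^ (-2 : ℝ)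
  have hk : Integrable k := by
    refine (integrable_indicator_iff measurableSet_Ioi).2 (integrableOn_Ioi_rpow_of_lt (by norm_num) hR)
  have hkI : ∫ x, k x = 1 / R := by
    rw [integral_indicator measurableSet_Ioi, integral_Ioi_rpow_of_lt (by norm_num) hR]
    norm_num [Real.rpow_neg_one]
  have hk' : Integrable (fun x => k (-x)) := hk.comp_neg
  have hkI' : ∫ x, k (-x) = 1 / R := by rw [integral_neg_eq_self k, hkI]
  have hg : Integrable ((Ioc (-R) R).indicator G) :=
    (integrable_indicator_iff measurableSet_Ioc).2 (hG.integrableOn_Icc.mono_set Ioc_subset_Icc_self)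
  have hgI : ∫ x, (Ioc (-R) R).indicator G x = ∫ x in (-R)..R, G x := by
    rw [integral_indicator measurableSet_Ioc, intervalIntegral.integral_of_le (by linarith)]
  have hk0 : ∀ x, 0 ≤ k x := fun x => indicator_nonneg (fun y (hy : R < y) => Real.rpow_nonneg (by linarith) _) x
  have hB0 : 0 ≤ B := (hu0 0).trans (hB 0)
  have hkv : ∀ x, R < x → k x = 1 / x ^ 2 := fun x hx => by
    have : x ∈ Ioi R := hx
    simp only [k, indicator_of_mem this]
    rw [Real.rpow_neg (by linarith)]
    norm_num
  calc ∫ x, u x * G x ≤ ∫ x, (B * (Ioc (-R) R).indicator G x + C * (k x + k (-x))) := by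
        refine integral_mono_of_nonneg (Eventually.of_forall fun x => mul_nonneg (hu0 x) (hG0 x))
          ((hg.const_mul B).add ((hk.add hk').const_mul C)) ?_
        have hne : ∀ᵐ x : ℝ, x ≠ -R := by
          simp [ae_iff]
        filter_upwards [hne] with x hxne
        by_cases hx : x ∈ Ioc (-R) R
        · rw [indicator_of_mem hx]
          have := mul_le_mul_of_nonneg_right (hB x) (hG0 x)
          have := mul_nonneg hC0 (add_nonneg (hk0 x) (hk0 (-x)))
          linarith
        · rw [indicator_of_notMem hx, mul_zero, zero_add]
          have h1 : u x * G x ≤ u x := mul_le_of_le_one_right (hu0 x) (hG1 x)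
          have h2 : 1 / x ^ 2 ≤ k x + k (-x) := by
            rcases lt_or_ge R x with h | h
            · rw [hkv x h]; linarith [hk0 (-x)]
            · have : R < -x := by
                rw [mem_Ioc, not_and_or] at hx
                rcases hx with hx | hx
                · have := lt_of_le_of_ne (not_lt.1 hx) hxne; linarith
                · exact absurd h hx
              rw [hkv (-x) this, neg_sq]; linarith [hk0 x]
          have h3 : R ≤ |x| := by
            by_contra hh
            rw [not_le, abs_lt] at hh
            exact hx ⟨hh.1, hh.2.le⟩
          have h4 := hC x h3
          have h5 := mul_le_mul_of_nonneg_left h2 hC0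
          rw [mul_one_div] at h5
          linarith
    _ = _ := by
        have hkk : Integrable (fun x => k x + k (-x)) := hk.add hk'
        rw [integral_add (hg.const_mul B) (hkk.const_mul C), integral_const_mul, integral_const_mul,
          hgI]
        rw [integral_add hk hk', hkI, hkI']
        ring

theorem stmt_4 {Ω : Type*} [MeasurableSpace Ω] (P : Measure Ω) [IsProbabilityMeasure P]
    (X : Ω → ℝ) (hXm : Measurable X) (hX1 : ∀ᵐ ω ∂P, |X ω| ≤ 1)
    (m : ℕ) (hm : 2 ≤ m) (α : ℕ → ℝ)
    (φ : ℝ → ℝ) (hφpos : ∀ t, 0 < t → 0 < φ t) (hφmono : MonotoneOn φ (Set.Ioi 0))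
    (ε : ℝ) (hε0 : 0 ≤ ε) (hεm : ε < 1 / m)
    (hφX : ∀ t : ℝ, 1 ≤ t → ∀ b : ℝ, 1 ≤ b →
      (∫ s in (-(b * t))..(b * t), ‖∫ ω, Complex.exp (Complex.I * (s : ℂ) * (X ω : ℂ)) ∂P‖) ≤
        b ^ ε * φ t) :
    ∃ c : ℝ, 0 < c ∧ ∀ t : ℝ, 1 ≤ |t| →
      ‖∫ ω, Complex.exp (Complex.I * (t : ℂ) *
          ((X ω ^ m + ∑ j ∈ Finset.range m, α j * X ω ^ j : ℝ) : ℂ)) ∂P‖ ≤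
        c * φ |t| * |t| ^ (-(1 : ℝ) / m) := by
  -- characteristic function
  set g : ℝ → ℝ := fun s => ‖∫ ω, Complex.exp (Complex.I * (s : ℂ) * (X ω : ℂ)) ∂P‖ with hg
  have hn1 : ∀ (s : ℝ) ω, ‖Complex.exp (Complex.I * (s : ℂ) * (X ω : ℂ))‖ = 1 := fun s ω => by
    rw [show Complex.I * (s : ℂ) * (X ω : ℂ) = ((s * X ω : ℝ) : ℂ) * Complex.I by push_cast; ring,
        Complex.norm_exp_ofReal_mul_I]
  have hg1 : ∀ s, g s ≤ 1 := fun s => by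
    refine (norm_integral_le_of_norm_le_const (C := 1) (Eventually.of_forall fun ω => (hn1 s ω).le)).trans ?_
    simp
  have hgc : Continuous g := by
    refine Continuous.norm ?_
    refine continuous_of_dominated (bound := fun _ => 1) (fun s => ?_)
      (fun s => Eventually.of_forall fun ω => (hn1 s ω).le) (integrable_const _)
      (Eventually.of_forall fun ω => by fun_prop)
    apply Measurable.aestronglyMeasurable
    fun_prop
  -- polynomial
  let F : Polynomial ℝ := Polynomial.X ^ m + ∑ j ∈ Finset.range m, Polynomial.C (α j) * Polynomial.X ^ j
  have hFe : ∀ x, F.eval x = x ^ m + ∑ j ∈ Finset.range m, α j * x ^ j := fun x => by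
    simp [F, Polynomial.eval_finsetSum]
  have hFd : ∀ x, (Polynomial.derivative^[m] F).eval x = m.factorial := fun x => by
    have : Polynomial.derivative^[m] (∑ j ∈ Finset.range m, Polynomial.C (α j) * Polynomial.X ^ j) = 0 := by
      rw [Polynomial.iterate_derivative_sum]
      refine Finset.sum_eq_zero fun j hj => ?_
      rw [Polynomial.iterate_derivative_C_mul, Polynomial.iterate_derivative_eq_zero, mul_zero]
      rw [Polynomial.natDegree_X_pow]; exact Finset.mem_range.1 hj
    simp only [F]
    rw [iterate_map_add, this, add_zero, Polynomial.iterate_derivative_X_pow_eq_natCast_mul]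
    simp [Nat.descFactorial_self]
  -- bump
  let χ : ContDiffBump (0 : ℝ) := ⟨1, 3 / 2, by norm_num, by norm_num⟩
  have hχs : ContDiff ℝ 2 χ := χ.contDiff
  have hχd : ∀ x, HasDerivAt χ (deriv χ x) x := fun x =>
    (hχs.differentiable (by norm_num)).differentiableAt.hasDerivAt
  have hχ1 : ContDiff ℝ 1 (deriv χ) := ((contDiff_succ_iff_deriv (n := 1)).1 hχs).2.2
  have hχd' : ∀ x, HasDerivAt (deriv χ) (deriv (deriv χ) x) x := fun x =>
    (hχ1.differentiable (by norm_num)).differentiableAt.hasDerivAt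
  have hχ2 : Continuous (deriv (deriv χ)) := hχ1.continuous_deriv (by norm_num)
  have hz : ∀ x : ℝ, 3 / 2 ≤ |x| → χ x = 0 := fun x hx => χ.zero_of_le_dist (by simpa using hx)
  have hz' : ∀ x : ℝ, 3 / 2 < |x| → deriv χ x = 0 := fun x hx => by
    have : (χ : ℝ → ℝ) =ᶠ[nhds x] fun _ => 0 := by
      filter_upwards [continuous_abs.continuousAt.eventually (lt_mem_nhds hx)] with y hy
      exact hz y (le_of_lt hy)
    rw [this.deriv_eq]; simp
  obtain ⟨D, hD⟩ := (isCompact_Icc (a := (-2 : ℝ)) (b := 2)).exists_bound_of_continuousOn hχ1.continuous.continuousOn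
  have hD0 : 0 ≤ D := (norm_nonneg _).trans (hD 0 (by simp))
  obtain ⟨A, C, hA1, hC0, htail⟩ := tail F χ (deriv χ) (deriv (deriv χ)) hχd hχd' hχ2
    (hz 2 (by norm_num)) (hz (-2) (by norm_num)) (hz' 2 (by norm_num)) (hz' (-2) (by norm_num))
  obtain ⟨V, hV0, hV⟩ := vdc_abs m hm
  have hφ1 : 0 < φ 1 := hφpos 1 one_pos
  have hpi : 3 < Real.pi := Real.pi_gt_three
  set B := D * V * 4 with hBdef
  have hB0 : 0 ≤ B := by positivity
  refine ⟨B * (2 * Real.pi * A) ^ ε + C * 2 / φ 1 + 1, by positivity, fun t ht => ?_⟩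
  have ht0 : 0 < |t| := by linarith
  have htne : t ≠ 0 := abs_pos.1 ht0
  have hm0 : (0 : ℝ) < m := by positivity
  let h0 : ℝ → ℂ := fun x => (χ x : ℂ) * eP (Polynomial.C t * F) x
  have hcs : HasCompactSupport h0 := by
    refine HasCompactSupport.mul_right ?_
    exact χ.hasCompactSupport.comp_left Complex.ofReal_zero
  have hsm : ContDiff ℝ (⊤ : ℕ∞) h0 := by
    refine (Complex.ofRealCLM.contDiff.comp χ.contDiff).mul ?_
    unfold eP
    refine (contDiff_const.mul (Complex.ofRealCLM.contDiff.comp ?_)).cexp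
    exact (Polynomial.C t * F).contDiff_aeval _
  let h := hcs.toSchwartzMap hsm
  have hh : ∀ x, h x = h0 x := fun x => rfl
  have hE : ∫ ω, Complex.exp (Complex.I * (t : ℂ) *
          ((X ω ^ m + ∑ j ∈ Finset.range m, α j * X ω ^ j : ℝ) : ℂ)) ∂P = ∫ ω, h (X ω) ∂P := by
    refine integral_congr_ae ?_
    filter_upwards [hX1] with ω hω
    have : χ (X ω) = 1 := χ.one_of_mem_closedBall (by simpa using hω)
    rw [hh]
    simp only [h0, this, eP]
    rw [Polynomial.eval_mul, Polynomial.eval_C, hFe]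
    push_cast
    rw [one_mul, mul_assoc]
  have hFour : ∀ ξ : ℝ, FourierTransform.fourier (h : ℝ → ℂ) ξ =
      ∫ x in (-2 : ℝ)..2, (χ x : ℂ) * eP (Polynomial.C t * F - Polynomial.C (2 * Real.pi * ξ) * Polynomial.X) x := by
    intro ξ
    rw [Real.fourier_eq', intervalIntegral.integral_of_le (by norm_num), ← integral_indicator measurableSet_Ioc]
    refine integral_congr_ae (Eventually.of_forall fun x => ?_)
    simp only [hh, h0, smul_eq_mul]
    by_cases hx : x ∈ Ioc (-2 : ℝ) 2
    · rw [indicator_of_mem hx, mul_left_comm]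
      congr 1
      unfold eP
      rw [← Complex.exp_add]
      congr 1
      simp
      ring
    · rw [indicator_of_notMem hx, hz x]
      · simp
      · by_contra hcon
        rw [not_le, abs_lt] at hcon
        exact hx ⟨by linarith [hcon.1], by linarith [hcon.2]⟩
  have hpos1 : 0 ≤ |t| ^ (-(1 : ℝ) / m) := by positivity
  have hunif : ∀ ξ : ℝ, ‖FourierTransform.fourier (h : ℝ → ℂ) ξ‖ ≤ B * |t| ^ (-(1 : ℝ) / m) := by
    intro ξ
    rw [hFour]
    have hf1 : (1 : ℝ) ≤ m.factorial := by exact_mod_cast Nat.one_le_iff_ne_zero.2 (Nat.factorial_ne_zero m)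
    refine (amp _ χ (deriv χ) hχd hχ1.continuous (hz 2 (by norm_num)) D (V * |t| ^ (-(1 : ℝ) / m)) hD ?_).trans
      (le_of_eq (by rw [hBdef]; ring))
    intro x hx
    have hv : t * m.factorial ≠ 0 := mul_ne_zero htne (by positivity)
    refine (hV _ (-2) x (t * m.factorial) hx.1 hv fun y _ => ?_).trans ?_
    · rw [Polynomial.iterate_derivative_sub, Polynomial.iterate_derivative_C_mul, Polynomial.iterate_derivative_C_mul,
        Polynomial.iterate_derivative_X (by omega)]
      simp [hFd]
    · refine mul_le_mul_of_nonneg_left ?_ hV0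
      refine Real.rpow_le_rpow_of_nonpos ht0 ?_ ?_
      · rw [abs_mul]
        refine le_mul_of_one_le_right (abs_nonneg _) (hf1.trans (le_abs_self _))
      · rw [neg_div]; have := one_div_pos.2 hm0; linarith
  set R := A * |t| with hR
  have hR0 : 0 < R := by positivity
  have htl : ∀ ξ : ℝ, R ≤ |ξ| → ‖FourierTransform.fourier (h : ℝ → ℂ) ξ‖ ≤ C / ξ ^ 2 := by
    intro ξ hξ
    have hξ0 : ξ ≠ 0 := by
      rintro rfl; rw [abs_zero] at hξ; linarith
    have hab : |ξ| ≤ |2 * Real.pi * ξ| := by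
      rw [abs_mul, abs_of_pos (by positivity : 0 < 2 * Real.pi)]
      nlinarith [abs_nonneg ξ]
    rw [hFour]
    refine (htail t (2 * Real.pi * ξ) (by positivity) (hξ.trans hab)).trans ?_
    exact div_le_div_of_nonneg_left hC0 (by positivity) (sq_le_sq.2 hab)
  rw [hE]
  refine (inv_bound P X hXm h).trans ?_
  refine (split_bound (fun ξ => ‖FourierTransform.fourier (h : ℝ → ℂ) ξ‖) (fun ξ => g (2 * Real.pi * ξ))
    (by fun_prop) (fun _ => norm_nonneg _) (fun _ => hg1 _) (fun _ => norm_nonneg _) R _ C hR0 hunif htl hC0).trans ?_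
  have hI : ∫ x in (-R)..R, g (2 * Real.pi * x) ≤ (2 * Real.pi * A) ^ ε * φ |t| := by
    rw [intervalIntegral.integral_comp_mul_left g (by positivity : 2 * Real.pi ≠ 0), smul_eq_mul]
    have hb : 1 ≤ 2 * Real.pi * A := by nlinarith
    have := hφX |t| ht (2 * Real.pi * A) hb
    rw [show 2 * Real.pi * -R = -(2 * Real.pi * A * |t|) by rw [hR]; ring,
      show 2 * Real.pi * R = (2 * Real.pi * A * |t|) by rw [hR]; ring]
    refine le_trans ?_ this
    refine mul_le_of_le_one_left ?_ (inv_le_one_of_one_le₀ (by linarith))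
    exact intervalIntegral.integral_nonneg (by nlinarith [mul_pos (by linarith : 0 < 2 * Real.pi * A) ht0]) fun _ _ => norm_nonneg _
  have hφt : φ 1 ≤ φ |t| := hφmono (mem_Ioi.2 one_pos) (mem_Ioi.2 ht0) ht
  have hφt0 : 0 < φ |t| := hφpos _ ht0
  have hRt : 1 / R ≤ |t| ^ (-(1 : ℝ) / m) := by
    calc 1 / R ≤ 1 / |t| := one_div_le_one_div_of_le ht0 (by rw [hR]; nlinarith)
      _ = |t| ^ (-1 : ℝ) := by rw [Real.rpow_neg_one, one_div]
      _ ≤ _ := Real.rpow_le_rpow_of_exponent_le ht (by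
          rw [neg_div, neg_le_neg_iff, div_le_one hm0]
          exact_mod_cast (by omega : 1 ≤ m))
  have hone : 1 ≤ φ |t| / φ 1 := (one_le_div hφ1).2 hφt
  have p1 : B * |t| ^ (-(1 : ℝ) / m) * (∫ x in (-R)..R, g (2 * Real.pi * x)) ≤
      B * |t| ^ (-(1 : ℝ) / m) * ((2 * Real.pi * A) ^ ε * φ |t|) :=
    mul_le_mul_of_nonneg_left hI (by positivity)
  have p2 : C * (2 / R) ≤ C * 2 * |t| ^ (-(1 : ℝ) / m) * (φ |t| / φ 1) := by
    calc C * (2 / R) = C * 2 * (1 / R) := by ring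
      _ ≤ C * 2 * |t| ^ (-(1 : ℝ) / m) := mul_le_mul_of_nonneg_left hRt (by positivity)
      _ ≤ _ := le_mul_of_one_le_right (by positivity) hone
  have p3 : 0 ≤ φ |t| * |t| ^ (-(1 : ℝ) / m) := by positivity
  refine (add_le_add p1 p2).trans ?_
  have : (B * (2 * Real.pi * A) ^ ε + C * 2 / φ 1 + 1) * φ |t| * |t| ^ (-(1 : ℝ) / m) =
    B * |t| ^ (-(1 : ℝ) / m) * ((2 * Real.pi * A) ^ ε * φ |t|) + C * 2 * |t| ^ (-(1 : ℝ) / m) * (φ |t| / φ 1)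
    + φ |t| * |t| ^ (-(1 : ℝ) / m) := by
    ring
  rw [this]
  linarith
end

section
/- Let L(t) = ∏_{j=1}^{∞} cos(2π · 3^{-j} t) be the characteristic function of the Cantor distribution. Then for every integer k ≥ 1, the k-fold convolution of the Cantor distribution with itself (the distribution with characteristic function L^k(t)) is a singular distribution (singular with respect to Lebesgue measure and continuous). -/
open MeasureTheory Real Set
open scoped Topology

theorem aux_weak {E : Type*} [NormedAddCommGroup E] [InnerProductSpace ℂ E] [CompleteSpace E]
    (v : ℕ → E) (B : ℝ) (hB : ∀ m, ‖v m‖ ≤ B)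
    (h : ∀ l, Filter.Tendsto (fun m => inner ℂ (v l) (v m)) Filter.atTop (𝓝 0)) (x : E) :
    Filter.Tendsto (fun m => inner ℂ x (v m)) Filter.atTop (𝓝 0) := by
  let S : Submodule ℂ E :=
    { carrier := {x | Filter.Tendsto (fun m => inner ℂ x (v m)) Filter.atTop (𝓝 0)}
      add_mem' := by
        intro a b ha hb
        simp only [mem_setOf_eq, inner_add_left] at *
        simpa using ha.add hb
      zero_mem' := by simp
      smul_mem' := by
        intro c a ha
        simp only [mem_setOf_eq, inner_smul_left] at *
        simpa using ha.const_mul _ }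
  have hB0 : 0 ≤ B := (norm_nonneg _).trans (hB 0)
  have hcl : IsClosed (S : Set E) := by
    rw [← closure_subset_iff_isClosed]
    intro y hy
    change Filter.Tendsto (fun m => inner ℂ y (v m)) Filter.atTop (𝓝 0)
    rw [Metric.tendsto_atTop]
    intro ε hε
    obtain ⟨z, hz, hyz⟩ := Metric.mem_closure_iff.1 hy (ε / (2 * (B + 1))) (by positivity)
    have hz' : Filter.Tendsto (fun m => inner ℂ z (v m)) Filter.atTop (𝓝 0) := hz
    obtain ⟨N, hN⟩ := Metric.tendsto_atTop.1 hz' (ε / 2) (by positivity)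
    refine ⟨N, fun n hn => ?_⟩
    have h1 := hN n hn
    rw [dist_zero_right] at h1 ⊢
    have h2 : inner ℂ y (v n) = inner ℂ (y - z) (v n) + inner ℂ z (v n) := by
      rw [← inner_add_left, sub_add_cancel]
    have h3 : ‖inner ℂ (y - z) (v n)‖ ≤ ε / 2 := by
      calc _ ≤ ‖y - z‖ * ‖v n‖ := norm_inner_le_norm _ _
        _ ≤ (ε / (2 * (B + 1))) * (B + 1) := by
          rw [dist_eq_norm] at hyz
          gcongr
          linarith [hB n]
        _ = ε / 2 := by field_simp
    rw [h2]
    linarith [norm_add_le (inner ℂ (y - z) (v n)) (inner ℂ z (v n))]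
  let K := (Submodule.span ℂ (Set.range v)).topologicalClosure
  have hK : K ≤ S := by
    apply Submodule.topologicalClosure_minimal _ _ hcl
    rw [Submodule.span_le]
    rintro _ ⟨l, rfl⟩
    exact h l
  have hvK : ∀ m, v m ∈ K := fun m =>
    Submodule.le_topologicalClosure _ (Submodule.subset_span ⟨m, rfl⟩)
  have hKo : Kᗮ ≤ S := by
    intro y hy
    change Filter.Tendsto (fun m => inner ℂ y (v m)) Filter.atTop (𝓝 0)
    have : ∀ m, inner ℂ y (v m) = 0 := fun m => (Submodule.mem_orthogonal' _ _).1 hy _ (hvK m)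
    simp [this]
  haveI : CompleteSpace K := (Submodule.isClosed_topologicalClosure _).completeSpace_coe
  have htop : K ⊔ Kᗮ = ⊤ := Submodule.sup_orthogonal_of_hasOrthogonalProjection
  have : (⊤ : Submodule ℂ E) ≤ S := htop ▸ sup_le hK hKo
  exact this (Submodule.mem_top : x ∈ ⊤)

theorem aux_mult (t : ℝ) :
    Multipliable (fun j : ℕ => Real.cos (2 * Real.pi * t / 3 ^ (j + 1))) := by
  have h : Summable (fun j : ℕ => Real.cos (2 * Real.pi * t / 3 ^ (j + 1)) - 1) := by
    have hg : Summable (fun j : ℕ => ((2 * Real.pi * t) ^ 2 / 18) * (1 / 9 : ℝ) ^ j) :=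
      (summable_geometric_of_lt_one (by norm_num) (by norm_num)).mul_left _
    refine Summable.of_norm_bounded hg fun j => ?_
    have h1 := Real.one_sub_sq_div_two_le_cos (x := 2 * Real.pi * t / 3 ^ (j + 1))
    have h2 := Real.cos_le_one (2 * Real.pi * t / 3 ^ (j + 1))
    have h3 : ((2 * Real.pi * t) ^ 2 / 18) * (1 / 9 : ℝ) ^ j
        = (2 * Real.pi * t / 3 ^ (j + 1)) ^ 2 / 2 := by
      have : (9 : ℝ) ^ j = (3 ^ j) ^ 2 := by rw [← pow_mul, mul_comm, pow_mul]; norm_num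
      rw [div_pow, div_pow, one_pow, this]
      field_simp
      ring
    rw [h3, Real.norm_eq_abs, abs_le]
    constructor <;> nlinarith
  simpa using Real.multipliable_one_add_of_summable h

theorem aux_fe (t : ℝ) :
    (∏' j : ℕ, Real.cos (2 * Real.pi * (3 * t) / 3 ^ (j + 1))) =
      Real.cos (2 * Real.pi * t) * ∏' j : ℕ, Real.cos (2 * Real.pi * t / 3 ^ (j + 1)) := by
  have e : ∀ j : ℕ, 2 * Real.pi * (3 * t) / 3 ^ (j + 1) = 2 * Real.pi * t / 3 ^ j := by
    intro j
    rw [pow_succ]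
    field_simp
  simp_rw [e]
  rw [tprod_eq_zero_mul' (f := fun j : ℕ => Real.cos (2 * Real.pi * t / 3 ^ j)) (aux_mult t)]
  simp

theorem aux_cos_ne (N : ℕ) : Real.cos (2 * Real.pi * (1 / 3 ^ (N + 1))) ≠ 0 := by
  intro h
  obtain ⟨n, hn⟩ := Real.cos_eq_zero_iff.1 h
  have h3 : (3 : ℝ) ^ (N + 1) ≠ 0 := by positivity
  field_simp at hn
  have : (4 : ℤ) = (2 * n + 1) * 3 ^ (N + 1) := by
    have h4 : (4 : ℝ) = (2 * n + 1) * 3 ^ (N + 1) := by linarith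
    exact_mod_cast h4
  have ho : Odd ((2 * n + 1) * 3 ^ (N + 1) : ℤ) := by
    apply Odd.mul ⟨n, rfl⟩
    exact Odd.pow (by decide)
  rw [← this] at ho
  exact absurd ho (by decide)

theorem aux_G_mem (ν : Measure ℝ) [IsProbabilityMeasure ν] (t : ℝ) :
    MemLp (fun x : ℝ => Complex.exp (Complex.I * (t : ℂ) * (x : ℂ))) 2 ν := by
  refine MemLp.of_bound (C := 1) ?_ ?_
  · exact (by fun_prop : Continuous _).aestronglyMeasurable
  · refine Filter.Eventually.of_forall fun x => ?_
    rw [show Complex.I * (t : ℂ) * (x : ℂ) = ((t * x : ℝ) : ℂ) * Complex.I by push_cast; ring,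
      Complex.norm_exp_ofReal_mul_I]

theorem aux_RL (μ : Measure ℝ) [IsFiniteMeasure μ] (h : μ ≪ volume) :
    Filter.Tendsto (fun m : ℕ => ∫ x, Complex.exp (Complex.I * ((3 ^ m : ℝ) : ℂ) * (x : ℂ)) ∂μ)
      Filter.atTop (𝓝 0) := by
  have h1 := Real.tendsto_integral_exp_smul_cocompact
    (fun x => ((μ.rnDeriv volume x).toReal : ℂ))
  have h2 : Filter.Tendsto (fun m : ℕ => -(3 ^ m : ℝ) / (2 * Real.pi)) Filter.atTop
      (Filter.cocompact ℝ) := by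
    refine Filter.Tendsto.mono_right ?_ atBot_le_cocompact
    refine Filter.Tendsto.atBot_div_const (by positivity) ?_
    exact Filter.tendsto_neg_atTop_atBot.comp (tendsto_pow_atTop_atTop_of_one_lt (by norm_num))
  refine (h1.comp h2).congr fun m => ?_
  rw [← integral_rnDeriv_smul h]
  refine integral_congr_ae (Filter.Eventually.of_forall fun x => ?_)
  simp only [Circle.smul_def, Real.fourierChar_apply, smul_eq_mul, Complex.real_smul]
  rw [mul_comm]
  congr 2
  have : (Real.pi : ℂ) ≠ 0 := by exact_mod_cast Real.pi_ne_zero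
  push_cast
  field_simp

theorem stmt_8 (k : ℕ) (hk : 1 ≤ k) (ν : Measure ℝ) [IsProbabilityMeasure ν]
    (hν : ∀ t : ℝ, (∫ x, Complex.exp (Complex.I * (t : ℂ) * (x : ℂ)) ∂ν) =
      ((∏' j : ℕ, Real.cos (2 * Real.pi * t / 3 ^ (j + 1)) : ℝ) : ℂ) ^ k) :
    ν ⟂ₘ (volume : Measure ℝ) ∧ ∀ x : ℝ, ν {x} = 0 := by
  obtain ⟨f, hf⟩ : ∃ f : ℝ → ℝ, f = fun t =>
    (∏' j : ℕ, Real.cos (2 * Real.pi * t / 3 ^ (j + 1))) ^ k := ⟨_, rfl⟩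
  have hfν : ∀ t : ℝ, (∫ x, Complex.exp (Complex.I * (t : ℂ) * (x : ℂ)) ∂ν) = (f t : ℂ) := by
    intro t
    rw [hν, hf]
    push_cast
    rfl
  have hfe : ∀ t, f (3 * t) = Real.cos (2 * Real.pi * t) ^ k * f t := by
    intro t
    simp only [hf]
    rw [aux_fe, mul_pow]
  have hf0 : f 0 = 1 := by simp [hf]
  have hfneg : ∀ t, f (-t) = f t := by
    intro t
    simp only [hf, mul_neg, neg_div, Real.cos_neg]
  have hfchar : ∀ t, charFun ν t = (f t : ℂ) := by
    intro t
    rw [← hfν, charFun_apply_real]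
    refine integral_congr_ae (Filter.Eventually.of_forall fun x => ?_)
    simp only
    congr 1
    ring
  have hfcont : Continuous f := by
    have h1 : Continuous (charFun ν) := continuous_charFun
    have h2 : f = fun t => (charFun ν t).re := by
      funext t
      rw [hfchar]
      simp
    rw [h2]
    exact Complex.continuous_re.comp h1
  have hfle : ∀ t, |f t| ≤ 1 := by
    intro t
    have := norm_charFun_le_one (μ := ν) t
    rwa [hfchar, Complex.norm_real] at this
  -- key identity
  have hkey : ∀ (N : ℕ) (s : ℝ), f (3 ^ N * (1 + s)) * f s = f (3 ^ N * s) * f (1 + s) := by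
    intro N s
    induction N with
    | zero => simp; ring
    | succ N ih =>
      have hc : Real.cos (2 * Real.pi * (3 ^ N * (1 + s))) =
          Real.cos (2 * Real.pi * (3 ^ N * s)) := by
        rw [← Real.cos_add_nat_mul_two_pi (2 * Real.pi * (3 ^ N * s)) (3 ^ N)]
        congr 1
        push_cast
        ring
      rw [pow_succ', mul_assoc, mul_assoc, hfe, hfe, hc]
      linear_combination (Real.cos (2 * Real.pi * (3 ^ N * s)) ^ k) * ih
  have hpow : ∀ N : ℕ, f (3 ^ N) = f 1 := by
    intro N
    have := hkey N 0
    simpa [hf0] using this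
  have hinv : Filter.Tendsto (fun N : ℕ => ((3 : ℝ) ^ N)⁻¹) Filter.atTop (𝓝 0) :=
    (tendsto_pow_atTop_atTop_of_one_lt (by norm_num : (1 : ℝ) < 3)).inv_tendsto_atTop
  have hlim : ∀ l : ℕ, Filter.Tendsto (fun N : ℕ => f (3 ^ N - 3 ^ l)) Filter.atTop
      (𝓝 (f 1 * f 1)) := by
    intro l
    have hs : Filter.Tendsto (fun N : ℕ => -(3 : ℝ) ^ l * ((3 : ℝ) ^ N)⁻¹) Filter.atTop (𝓝 0) := by
      simpa using hinv.const_mul (-(3 : ℝ) ^ l)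
    have ha : Filter.Tendsto (fun N : ℕ => f (-(3 : ℝ) ^ l * ((3 : ℝ) ^ N)⁻¹)) Filter.atTop
        (𝓝 1) := by
      have := (hfcont.tendsto 0).comp hs
      rwa [hf0] at this
    have hb : Filter.Tendsto (fun N : ℕ => f (1 + -(3 : ℝ) ^ l * ((3 : ℝ) ^ N)⁻¹)) Filter.atTop
        (𝓝 (f 1)) := by
      have h1 := hs.const_add 1
      rw [add_zero] at h1
      exact (hfcont.tendsto 1).comp h1
    have hq := (hb.const_mul (f 1)).div ha one_ne_zero
    rw [div_one] at hq
    refine hq.congr' ?_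
    filter_upwards [ha.eventually_ne one_ne_zero] with N hN
    have := hkey N (-(3 : ℝ) ^ l * ((3 : ℝ) ^ N)⁻¹)
    have e1 : (3 : ℝ) ^ N * (1 + -(3 : ℝ) ^ l * ((3 : ℝ) ^ N)⁻¹) = 3 ^ N - 3 ^ l := by
      field_simp
      ring
    have e2 : (3 : ℝ) ^ N * (-(3 : ℝ) ^ l * ((3 : ℝ) ^ N)⁻¹) = -3 ^ l := by
      field_simp
    rw [e1, e2, hfneg, hpow] at this
    simp only [Pi.div_apply]
    rw [div_eq_iff hN, this]
  -- bounds on f 1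
  have hc1 : f 1 ≠ 0 := by
    intro h1
    have hz : ∀ N : ℕ, f (1 / 3 ^ N) = 0 := by
      intro N
      induction N with
      | zero => simpa using h1
      | succ N ih =>
        have h2 := hfe (1 / 3 ^ (N + 1))
        have e : 3 * (1 / 3 ^ (N + 1)) = (1 / 3 ^ N : ℝ) := by
          rw [pow_succ]
          field_simp
        rw [e, ih] at h2
        exact (mul_eq_zero.1 h2.symm).resolve_left (pow_ne_zero _ (aux_cos_ne N))
    have h3 := (hfcont.tendsto 0).comp hinv
    have h4 : (f ∘ fun N : ℕ => ((3 : ℝ) ^ N)⁻¹) = fun _ => 0 := by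
      funext N
      simpa using hz N
    rw [h4, hf0] at h3
    exact zero_ne_one (tendsto_nhds_unique tendsto_const_nhds h3)
  have hc2 : |f 1| < 1 := by
    have h1 := hfe (1 / 3)
    have h2 : |Real.cos (2 * Real.pi * (1 / 3))| = 1 / 2 := by
      rw [show 2 * Real.pi * (1 / 3) = Real.pi - Real.pi / 3 by ring, Real.cos_pi_sub,
        Real.cos_pi_div_three, abs_neg, abs_of_pos (by norm_num)]
    rw [show (3 : ℝ) * (1 / 3) = 1 by norm_num] at h1
    rw [h1, abs_mul, abs_pow, h2]
    have h3 : (1 / 2 : ℝ) ^ k ≤ 1 / 2 := pow_le_of_le_one (by norm_num) (by norm_num) (by omega)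
    nlinarith [hfle (1 / 3), abs_nonneg (f (1 / 3))]
  -- weak convergence
  let G : ℝ → Lp ℂ 2 ν := fun t => (aux_G_mem ν t).toLp _
  have hGG : ∀ s t, inner ℂ (G s) (G t) = (f (t - s) : ℂ) := by
    intro s t
    rw [L2.inner_def, ← hfν]
    refine integral_congr_ae ?_
    filter_upwards [(aux_G_mem ν s).coeFn_toLp, (aux_G_mem ν t).coeFn_toLp] with x hx hy
    simp only [G]
    rw [hx, hy]
    simp only [RCLike.inner_apply, ← Complex.exp_conj, ← Complex.exp_add, map_mul,
      Complex.conj_I, Complex.conj_ofReal]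
    congr 1
    push_cast
    ring
  let v : ℕ → Lp ℂ 2 ν := fun m => G (3 ^ m) - (f 1 : ℂ) • G 0
  have hvv : ∀ l m, inner ℂ (v l) (v m) = ((f (3 ^ m - 3 ^ l) - f 1 * f 1 : ℝ) : ℂ) := by
    intro l m
    simp only [v, inner_sub_left, inner_sub_right, inner_smul_left, inner_smul_right, hGG,
      sub_zero, zero_sub, hfneg, hpow, hf0, Complex.conj_ofReal]
    push_cast
    ring
  have hGn : ∀ t, ‖G t‖ = 1 := by
    intro t
    have h1 : (inner ℂ (G t) (G t) : ℂ) = (‖G t‖ : ℂ) ^ 2 := inner_self_eq_norm_sq_to_K (G t)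
    rw [hGG, sub_self, hf0] at h1
    have h2 : (1 : ℝ) = ‖G t‖ ^ 2 := by exact_mod_cast h1
    nlinarith [norm_nonneg (G t)]
  have hvB : ∀ m, ‖v m‖ ≤ 2 := by
    intro m
    calc ‖v m‖ ≤ ‖G (3 ^ m)‖ + ‖(f 1 : ℂ) • G 0‖ := norm_sub_le _ _
      _ ≤ 2 := by
        rw [norm_smul, hGn, hGn, Complex.norm_real, Real.norm_eq_abs]
        linarith
  have hweak : ∀ A : Set ℝ, MeasurableSet A → Filter.Tendsto
      (fun m : ℕ => ∫ x in A, Complex.exp (Complex.I * ((3 ^ m : ℝ) : ℂ) * (x : ℂ)) ∂ν)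
      Filter.atTop (𝓝 ((f 1 : ℂ) * (ν.real A : ℂ))) := by
    intro A hA
    have hw := aux_weak v 2 hvB (by
      intro l
      simp only [hvv]
      have := (hlim l).sub_const (f 1 * f 1)
      rw [sub_self] at this
      exact_mod_cast (Complex.continuous_ofReal.tendsto 0).comp this)
      (indicatorConstLp 2 hA (measure_ne_top ν A) (1 : ℂ))
    have hI : ∀ t, inner ℂ (indicatorConstLp 2 hA (measure_ne_top ν A) (1 : ℂ)) (G t) =
        ∫ x in A, Complex.exp (Complex.I * (t : ℂ) * (x : ℂ)) ∂ν := by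
      intro t
      rw [L2.inner_indicatorConstLp_one]
      exact integral_congr_ae (ae_restrict_of_ae (aux_G_mem ν t).coeFn_toLp)
    have hI0 : ∫ x in A, Complex.exp (Complex.I * ((0 : ℝ) : ℂ) * (x : ℂ)) ∂ν
        = (ν.real A : ℂ) := by
      simp
    simp only [v, inner_sub_right, inner_smul_right, hI, hI0] at hw
    have := hw.add_const ((f 1 : ℂ) * (ν.real A : ℂ))
    simpa using this
  have hfC : (f 1 : ℂ) ≠ 0 := by exact_mod_cast hc1
  constructor
  · have hdec := ν.haveLebesgueDecomposition_add (volume : Measure ℝ)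
    obtain ⟨S, hS, hS1, hS2⟩ := ν.mutuallySingular_singularPart (volume : Measure ℝ)
    have hac : ν.restrict S ≪ volume := by
      have : ν.restrict S = (volume.withDensity (ν.rnDeriv volume)).restrict S := by
        conv_lhs => rw [hdec]
        rw [Measure.restrict_add, Measure.restrict_eq_zero.2 hS1, zero_add]
      rw [this]
      exact Measure.absolutelyContinuous_of_le Measure.restrict_le_self |>.trans
        (withDensity_absolutelyContinuous _ _)
    have h1 := aux_RL (ν.restrict S) hac
    have h2 := tendsto_nhds_unique h1 (hweak S hS)
    have h3 : ν.real S = 0 := by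
      have := (mul_eq_zero.1 h2.symm).resolve_left hfC
      exact_mod_cast this
    refine ⟨S, hS, ?_, hS2⟩
    exact (measureReal_eq_zero_iff).1 h3
  · intro x
    have h1 := (hweak {x} (measurableSet_singleton x)).norm
    have h2 : ∀ m : ℕ, ‖∫ y in ({x} : Set ℝ),
        Complex.exp (Complex.I * ((3 ^ m : ℝ) : ℂ) * (y : ℂ)) ∂ν‖ = ν.real {x} := by
      intro m
      rw [integral_singleton, norm_smul,
        show Complex.I * ((3 ^ m : ℝ) : ℂ) * (x : ℂ) = ((3 ^ m * x : ℝ) : ℂ) * Complex.I by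
          push_cast; ring, Complex.norm_exp_ofReal_mul_I, mul_one, Real.norm_eq_abs,
        abs_of_nonneg measureReal_nonneg]
    simp only [h2] at h1
    have h3 := tendsto_nhds_unique tendsto_const_nhds h1
    rw [norm_mul, Complex.norm_real, Complex.norm_real, Real.norm_eq_abs, Real.norm_eq_abs,
      abs_of_nonneg (measureReal_nonneg (μ := ν) (s := {x}))] at h3
    have h4 : ν.real {x} = 0 := by
      nlinarith [measureReal_nonneg (μ := ν) (s := {x})]
    exact (measureReal_eq_zero_iff).1 h4
end
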